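/- arXiv:2106.00827 — 8 statements merged into one kernel-verified Lean document; each statement's English description precedes it below -/
import Mathlib

section
/- For any finite set of distinct points x₁, …, xₘ in Euclidean space ℝⁿ, the m × m matrix ζ with entries ζ(i,j) = exp(−‖xᵢ − xⱼ‖) is a symmetric positive definite matrix; in particular ζ is invertible. -/
open Matrix

section QuadraticForm

variable {ι : Type*} [Fintype ι]

theorem dotProduct_mulVec_eq_sum (A : Matrix ι ι ℝ) (c : ι → ℝ) :
    star c ⬝ᵥ (A *ᵥ c) = ∑ i, ∑ j, c i * c j * A i j := by
  simp only [dotProduct, mulVec, Finset.mul_sum, star_trivial]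
  exact Finset.sum_congr rfl fun i _ => Finset.sum_congr rfl fun j _ => by ring

theorem sum_mul_sum_eq_sq (c : ι → ℝ) : ∑ i, ∑ j, c i * c j = (∑ i, c i) ^ 2 := by
  rw [sq, Finset.sum_mul_sum]

theorem Matrix.PosSemidef.map_pow {A : Matrix ι ι ℝ} (hA : A.PosSemidef) (k : ℕ) :
    (A.map (· ^ k)).PosSemidef := by
  induction k with
  | zero =>
    have h : A.map (· ^ 0) = vecMulVec 1 (star 1) := by ext i j; simp [vecMulVec_apply]
    rw [h]
    exact posSemidef_vecMulVec_self_star _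
  | succ k ih =>
    have h : A.map (· ^ (k + 1)) = A.map (· ^ k) ⊙ A := by ext i j; simp [pow_succ]
    rw [h]
    exact ih.hadamard hA

/-- The entrywise exponential of a positive semidefinite matrix dominates the first two terms of
its power series. -/
theorem Matrix.PosSemidef.sq_add_le_sum_exp {A : Matrix ι ι ℝ} (hA : A.PosSemidef) (c : ι → ℝ) :
    (∑ i, c i) ^ 2 + ∑ i, ∑ j, c i * c j * A i j ≤ ∑ i, ∑ j, c i * c j * Real.exp (A i j) := by
  have hs : HasSum (fun k : ℕ => ∑ i, ∑ j, c i * c j * (A i j ^ k / (k.factorial : ℝ)))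
      (∑ i, ∑ j, c i * c j * Real.exp (A i j)) := by
    refine hasSum_sum fun i _ => hasSum_sum fun j _ => HasSum.mul_left _ ?_
    rw [Real.exp_eq_exp_ℝ]
    exact NormedSpace.expSeries_div_hasSum_exp (A i j)
  have hnn : ∀ k : ℕ, 0 ≤ ∑ i, ∑ j, c i * c j * (A i j ^ k / (k.factorial : ℝ)) := fun k => by
    have h := (hA.map_pow k).dotProduct_mulVec_nonneg c
    rw [dotProduct_mulVec_eq_sum] at h
    have h' := div_nonneg h (Nat.cast_nonneg (α := ℝ) k.factorial)
    simpa only [Finset.sum_div, mul_div_assoc, map_apply] using h'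
  have h := sum_le_hasSum (Finset.range 2) (fun k _ => hnn k) hs
  simpa [Finset.sum_range_succ, sum_mul_sum_eq_sq] using h

end QuadraticForm

section Kernel

open MeasureTheory Filter Topology

variable {ι E : Type*} [Fintype ι] [NormedAddCommGroup E]

theorem integrable_one_sub_exp_neg_inv_sq :
    Integrable fun v : ℝ => 1 - Real.exp (-(v⁻¹) ^ 2) := by
  refine (integrable_inv_one_add_sq.const_mul 2).mono' (by fun_prop) (ae_of_all _ fun v => ?_)
  have h1 : Real.exp (-(v⁻¹) ^ 2) ≤ 1 := Real.exp_le_one_iff.2 (by nlinarith [sq_nonneg v⁻¹])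
  rw [Real.norm_of_nonneg (by linarith), ← div_eq_mul_inv, le_div_iff₀ (by positivity)]
  rcases eq_or_ne v 0 with rfl | hv
  · simp
  have h2 : 1 - Real.exp (-(v⁻¹) ^ 2) ≤ (v⁻¹) ^ 2 := by
    linarith [Real.add_one_le_exp (-(v⁻¹) ^ 2)]
  have h3 : (v⁻¹) ^ 2 * v ^ 2 = 1 := by rw [← mul_pow, inv_mul_cancel₀ hv, one_pow]
  nlinarith [mul_le_mul_of_nonneg_right h2 (sq_nonneg v), Real.exp_pos (-(v⁻¹) ^ 2)]

theorem integral_one_sub_exp_neg_inv_sq_pos :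
    0 < ∫ v : ℝ, (1 - Real.exp (-(v⁻¹) ^ 2)) := by
  have hsupp : Set.Ioi (0 : ℝ) ⊆ Function.support fun v : ℝ => 1 - Real.exp (-(v⁻¹) ^ 2) := by
    intro v hv h
    have hv' : (0 : ℝ) < v := hv
    have h1 : Real.exp (-(v⁻¹) ^ 2) < 1 :=
      Real.exp_lt_one_iff.2 (neg_lt_zero.2 (pow_pos (inv_pos.2 hv') 2))
    exact h1.ne' (sub_eq_zero.1 h)
  rw [integral_pos_iff_support_of_nonneg (fun v => by simpa using sq_nonneg v)
    integrable_one_sub_exp_neg_inv_sq]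
  exact lt_of_lt_of_le (by simp) (measure_mono hsupp)

theorem integrable_one_sub_exp_neg_div_sq (r : ℝ) :
    Integrable fun u : ℝ => 1 - Real.exp (-(r / u) ^ 2) := by
  rcases eq_or_ne r 0 with rfl | hr
  · simp
  · simpa only [inv_div] using integrable_one_sub_exp_neg_inv_sq.comp_div hr

theorem integral_one_sub_exp_neg_div_sq {r : ℝ} (hr : 0 ≤ r) :
    ∫ u : ℝ, (1 - Real.exp (-(r / u) ^ 2)) = r * ∫ v : ℝ, (1 - Real.exp (-(v⁻¹) ^ 2)) := by
  simpa only [inv_div, abs_of_nonneg hr, smul_eq_mul] using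
    Measure.integral_comp_div (fun v : ℝ => 1 - Real.exp (-(v⁻¹) ^ 2)) r

theorem sum_mul_exp_neg_div_sq_eq (x : ι → E) {c : ι → ℝ} (hsum : ∑ i, c i = 0) (u : ℝ) :
    ∑ i, ∑ j, c i * c j * Real.exp (-(dist (x i) (x j) / u) ^ 2) =
      -∑ i, ∑ j, c i * c j * (1 - Real.exp (-(dist (x i) (x j) / u) ^ 2)) := by
  simp [mul_sub, Finset.sum_sub_distrib, sum_mul_sum_eq_sq, hsum]

theorem tendsto_sum_mul_exp_neg_div_sq {x : ι → E} (hx : Function.Injective x) (c : ι → ℝ) :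
    Tendsto (fun u : ℝ => ∑ i, ∑ j, c i * c j * Real.exp (-(dist (x i) (x j) / u) ^ 2))
      (𝓝[≠] 0) (𝓝 (∑ i, c i ^ 2)) := by
  classical
  have e : ∑ i, c i ^ 2 = ∑ i, ∑ j, c i * c j * (if i = j then 1 else 0) := by
    simp [sq]
  rw [e]
  refine tendsto_finsetSum _ fun i _ => tendsto_finsetSum _ fun j _ => Tendsto.const_mul _ ?_
  split_ifs with hij
  · simp [hij]
  · have hd : 0 < dist (x i) (x j) := dist_pos.2 (hx.ne hij)
    have h1 : Tendsto (fun u : ℝ => (dist (x i) (x j) / u) ^ 2) (𝓝[≠] 0) atTop := by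
      have h2 : Tendsto (fun u : ℝ => ‖u⁻¹‖) (𝓝[≠] 0) atTop := tendsto_norm_inv_nhdsNE_zero_atTop
      have h3 := (tendsto_pow_atTop two_ne_zero).comp (h2.const_mul_atTop hd)
      refine h3.congr fun u => ?_
      simp [div_eq_mul_inv, mul_pow]
    simpa only [Function.comp_def] using Real.tendsto_exp_neg_atTop_nhds_zero.comp h1

theorem sum_mul_norm_add_norm_sub_dist (x : ι → E) (c : ι → ℝ) :
    ∑ i, ∑ j, c i * c j * (‖x i‖ + ‖x j‖ - dist (x i) (x j)) =
      2 * (∑ i, c i) * (∑ i, c i * ‖x i‖) - ∑ i, ∑ j, c i * c j * dist (x i) (x j) := by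
  have h1 : ∑ i, ∑ j, c i * c j * ‖x i‖ = (∑ i, c i * ‖x i‖) * ∑ i, c i := by
    rw [Finset.sum_mul_sum]
    exact Finset.sum_congr rfl fun i _ => Finset.sum_congr rfl fun j _ => by ring
  have h2 : ∑ i, ∑ j, c i * c j * ‖x j‖ = (∑ i, c i) * ∑ i, c i * ‖x i‖ := by
    rw [Finset.sum_mul_sum]
    exact Finset.sum_congr rfl fun i _ => Finset.sum_congr rfl fun j _ => by ring
  simp only [mul_sub, mul_add, Finset.sum_sub_distrib, Finset.sum_add_distrib, h1, h2]
  ring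

theorem integrable_sum_mul_exp_neg_div_sq (x : ι → E) {c : ι → ℝ} (hsum : ∑ i, c i = 0) :
    Integrable fun u : ℝ =>
      ∑ i, ∑ j, c i * c j * Real.exp (-(dist (x i) (x j) / u) ^ 2) := by
  rw [funext (sum_mul_exp_neg_div_sq_eq x hsum)]
  exact (integrable_finsetSum _ fun i _ => integrable_finsetSum _ fun j _ =>
    (integrable_one_sub_exp_neg_div_sq _).const_mul _).neg

theorem integral_sum_mul_exp_neg_div_sq (x : ι → E) {c : ι → ℝ} (hsum : ∑ i, c i = 0) :
    ∫ u : ℝ, ∑ i, ∑ j, c i * c j * Real.exp (-(dist (x i) (x j) / u) ^ 2) =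
      -((∑ i, ∑ j, c i * c j * dist (x i) (x j)) *
        ∫ v : ℝ, (1 - Real.exp (-(v⁻¹) ^ 2))) := by
  have hint : ∀ i j, Integrable fun u : ℝ =>
      c i * c j * (1 - Real.exp (-(dist (x i) (x j) / u) ^ 2)) := fun i j =>
    (integrable_one_sub_exp_neg_div_sq _).const_mul _
  rw [funext (sum_mul_exp_neg_div_sq_eq x hsum), integral_neg,
    integral_finsetSum _ fun i _ => integrable_finsetSum _ fun j _ => hint i j]
  simp_rw [integral_finsetSum _ fun j _ => hint _ j, integral_const_mul,
    integral_one_sub_exp_neg_div_sq dist_nonneg, Finset.sum_mul, mul_assoc]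

variable [InnerProductSpace ℝ E]

theorem sum_mul_exp_neg_sq_dist_nonneg (x : ι → E) (c : ι → ℝ) {s : ℝ} (hs : 0 ≤ s) :
    0 ≤ ∑ i, ∑ j, c i * c j * Real.exp (-(s * dist (x i) (x j) ^ 2)) := by
  have hK : ((2 * s) • gram ℝ x).PosSemidef := (posSemidef_gram ℝ x).smul (by positivity)
  have h := hK.sq_add_le_sum_exp fun i => c i * Real.exp (-(s * ‖x i‖ ^ 2))
  have h0 := hK.dotProduct_mulVec_nonneg fun i => c i * Real.exp (-(s * ‖x i‖ ^ 2))
  rw [dotProduct_mulVec_eq_sum] at h0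
  refine (add_nonneg (sq_nonneg _) h0).trans (h.trans_eq ?_)
  refine Finset.sum_congr rfl fun i _ => Finset.sum_congr rfl fun j _ => ?_
  have e : -(s * dist (x i) (x j) ^ 2)
      = -(s * ‖x i‖ ^ 2) + -(s * ‖x j‖ ^ 2) + ((2 * s) • gram ℝ x) i j := by
    rw [dist_eq_norm, norm_sub_sq_real, Matrix.smul_apply, gram_apply, smul_eq_mul]
    ring
  rw [e, Real.exp_add, Real.exp_add]
  ring

theorem sum_mul_exp_neg_div_sq_nonneg (x : ι → E) (c : ι → ℝ) (u : ℝ) :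
    0 ≤ ∑ i, ∑ j, c i * c j * Real.exp (-(dist (x i) (x j) / u) ^ 2) := by
  have h := sum_mul_exp_neg_sq_dist_nonneg x c (s := (u⁻¹) ^ 2) (sq_nonneg _)
  simpa only [div_eq_mul_inv, mul_pow, mul_comm (u⁻¹ ^ 2)] using h

/-- Distance matrices are conditionally negative definite. -/
theorem sum_mul_dist_nonpos (x : ι → E) {c : ι → ℝ} (hsum : ∑ i, c i = 0) :
    ∑ i, ∑ j, c i * c j * dist (x i) (x j) ≤ 0 := by
  have h : 0 ≤ ∫ u : ℝ, ∑ i, ∑ j, c i * c j * Real.exp (-(dist (x i) (x j) / u) ^ 2) :=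
    integral_nonneg fun u => sum_mul_exp_neg_div_sq_nonneg x c u
  rw [integral_sum_mul_exp_neg_div_sq x hsum] at h
  by_contra! h'
  linarith [mul_pos h' integral_one_sub_exp_neg_inv_sq_pos]

/-- Distance matrices of distinct points are strictly conditionally negative definite. -/
theorem sum_mul_dist_neg {x : ι → E} (hx : Function.Injective x) {c : ι → ℝ} (hc : c ≠ 0)
    (hsum : ∑ i, c i = 0) : ∑ i, ∑ j, c i * c j * dist (x i) (x j) < 0 := by
  have hsq : 0 < ∑ i, c i ^ 2 := by
    obtain ⟨i, hi⟩ := Function.ne_iff.1 hc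
    exact Finset.sum_pos' (fun j _ => sq_nonneg _) ⟨i, Finset.mem_univ _, sq_pos_of_ne_zero hi⟩
  have hsupp : Function.support (fun u : ℝ =>
      ∑ i, ∑ j, c i * c j * Real.exp (-(dist (x i) (x j) / u) ^ 2)) ∈ 𝓝[≠] (0 : ℝ) :=
    ((tendsto_sum_mul_exp_neg_div_sq hx c).eventually (lt_mem_nhds hsq)).mono fun u hu => hu.ne'
  have hpos := (integral_pos_iff_support_of_nonneg (μ := volume)
    (sum_mul_exp_neg_div_sq_nonneg x c) (integrable_sum_mul_exp_neg_div_sq x hsum)).2 (by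
      rw [← measure_congr (insert_ae_eq_self (0 : ℝ) _)]
      exact Measure.measure_pos_of_mem_nhds _ (insert_mem_nhds_iff.2 hsupp))
  rw [integral_sum_mul_exp_neg_div_sq x hsum] at hpos
  by_contra! h
  linarith [mul_nonneg h integral_one_sub_exp_neg_inv_sq_pos.le]

theorem posSemidef_norm_add_norm_sub_dist (x : ι → E) :
    (Matrix.of fun i j => ‖x i‖ + ‖x j‖ - dist (x i) (x j)).PosSemidef := by
  refine .of_dotProduct_mulVec_nonneg ?_ fun c => ?_
  · ext i j
    simp [dist_comm, add_comm]
  rw [dotProduct_mulVec_eq_sum]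
  simp only [of_apply]
  rw [sum_mul_norm_add_norm_sub_dist]
  have h := sum_mul_dist_nonpos (fun o : Option ι => o.elim 0 x)
    (c := fun o => o.elim (-∑ i, c i) c) (by simp [Fintype.sum_option])
  have h1 : ∑ i, c i * (-∑ k, c k) * ‖x i‖ = -((∑ i, c i) * ∑ i, c i * ‖x i‖) := by
    rw [← neg_mul, Finset.mul_sum]
    exact Finset.sum_congr rfl fun i _ => by ring
  have h2 : ∑ i, (∑ k, c k) * c i * ‖x i‖ = (∑ i, c i) * ∑ i, c i * ‖x i‖ := by
    rw [Finset.mul_sum]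
    exact Finset.sum_congr rfl fun i _ => by ring
  simp only [Fintype.sum_option, Option.elim_none, Option.elim_some,
    dist_zero_left, dist_zero_right, norm_zero, mul_zero, zero_add, Finset.sum_add_distrib, h1,
    neg_mul, Finset.sum_neg_distrib, h2] at h
  linarith

theorem posDef_exp_neg_dist {x : ι → E} (hx : Function.Injective x) :
    (Matrix.of fun i j => Real.exp (-dist (x i) (x j))).PosDef := by
  refine .of_dotProduct_mulVec_pos ?_ fun c hc => ?_
  · ext i j
    simp [dist_comm]
  rw [dotProduct_mulVec_eq_sum]
  set b : ι → ℝ := fun i => c i * Real.exp (-‖x i‖) with hb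
  have hb0 : b ≠ 0 := by
    obtain ⟨i, hi⟩ := Function.ne_iff.1 hc
    exact Function.ne_iff.2 ⟨i, mul_ne_zero hi (Real.exp_ne_zero _)⟩
  have hK := posSemidef_norm_add_norm_sub_dist x
  have h0 := hK.dotProduct_mulVec_nonneg b
  have h := hK.sq_add_le_sum_exp b
  rw [dotProduct_mulVec_eq_sum] at h0
  have e : ∑ i, ∑ j, b i * b j * Real.exp ((Matrix.of fun i j =>
      ‖x i‖ + ‖x j‖ - dist (x i) (x j)) i j) =
      ∑ i, ∑ j, c i * c j * (Matrix.of fun i j => Real.exp (-dist (x i) (x j))) i j := by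
    refine Finset.sum_congr rfl fun i _ => Finset.sum_congr rfl fun j _ => ?_
    have e' : -dist (x i) (x j) =
        -‖x i‖ + -‖x j‖ + (‖x i‖ + ‖x j‖ - dist (x i) (x j)) := by ring
    rw [of_apply, of_apply, e', Real.exp_add, Real.exp_add, hb]
    ring
  rw [e] at h
  refine lt_of_lt_of_le ?_ h
  by_cases hs : ∑ i, b i = 0
  · simp only [of_apply]
    rw [sum_mul_norm_add_norm_sub_dist, hs]
    linarith [sum_mul_dist_neg hx hb0 hs]
  · have := sq_pos_of_ne_zero hs
    linarith

end Kernel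

/-- For any finite set of distinct points x₁, …, xₘ in Euclidean space ℝⁿ,
the m × m matrix ζ with entries ζ(i,j) = exp(−‖xᵢ − xⱼ‖) is a symmetric positive
definite matrix; in particular ζ is invertible. -/
theorem similarity_matrix_posDef {n m : ℕ} (x : Fin m → EuclideanSpace ℝ (Fin n))
    (hx : Function.Injective x) :
    (Matrix.of fun i j : Fin m => Real.exp (-dist (x i) (x j))).IsSymm ∧
    (Matrix.of fun i j : Fin m => Real.exp (-dist (x i) (x j))).PosDef ∧
    IsUnit (Matrix.of fun i j : Fin m => Real.exp (-dist (x i) (x j))).det := by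
  have h := posDef_exp_neg_dist hx
  refine ⟨?_, h, h.det_pos.ne'.isUnit⟩
  ext i j
  simp [dist_comm]
end

section
/- Let X = {x₁, …, xₘ} be a finite set of distinct points in ℝⁿ. Then Mag(tX) = 𝟙ᵀ ζ_{tX}⁻¹ 𝟙 tends to m, the number of points of X, as t → ∞. -/
open Matrix

/-- The similarity matrix `exp (-(t * d(x i, x j)))` of a finite family of distinct points tends to
the identity matrix as the scale `t` goes to infinity. -/
theorem tendsto_similarityMatrix_one {ι X : Type*} [DecidableEq ι] [MetricSpace X] {x : ι → X}
    (hx : Function.Injective x) :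
    Filter.Tendsto
      (fun t : ℝ => Matrix.of fun i j => Real.exp (-(t * dist (x i) (x j))))
      Filter.atTop (nhds (1 : Matrix ι ι ℝ)) := by
  refine tendsto_pi_nhds.2 fun i => tendsto_pi_nhds.2 fun j => ?_
  rcases eq_or_ne i j with rfl | hij
  · simp
  · have hd : 0 < dist (x i) (x j) := dist_pos.2 (hx.ne hij)
    simpa [Matrix.one_apply_ne hij] using
      Filter.tendsto_id.atTop_mul_const hd

/-- For a finite set X = {x₁, …, xₘ} of distinct points in ℝⁿ,
Mag(tX) = 𝟙ᵀ ζ_{tX}⁻¹ 𝟙 tends to m as t → ∞. -/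
theorem magnitude_tendsto_card {n m : ℕ} (x : Fin m → EuclideanSpace ℝ (Fin n))
    (hx : Function.Injective x) :
    Filter.Tendsto
      (fun t : ℝ =>
        dotProduct (fun _ : Fin m => (1 : ℝ))
          ((Matrix.of fun i j : Fin m => Real.exp (-(t * dist (x i) (x j))))⁻¹ *ᵥ
            fun _ : Fin m => (1 : ℝ)))
      Filter.atTop (nhds (m : ℝ)) := by
  have hinv : ContinuousAt Ring.inverse (1 : Matrix (Fin m) (Fin m) ℝ).det := by simp
  have h := (continuousAt_matrix_inv _ hinv).tendsto.comp (tendsto_similarityMatrix_one hx)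
  have hc : Continuous fun A : Matrix (Fin m) (Fin m) ℝ =>
      dotProduct (fun _ : Fin m => (1 : ℝ)) (A *ᵥ fun _ : Fin m => (1 : ℝ)) := by fun_prop
  simpa [Function.comp_def, dotProduct] using (hc.tendsto _).comp h
end

section
/- Let X ⊆ ℝⁿ be nonempty and compact. Then Mag(tX) → 1 as t → 0⁺, where Mag(tX) = sup{ 𝟙ᵀ ζ_{tY}⁻¹ 𝟙 : Y a finite subset of X } and ζ_{tY}(i,j) = exp(−t‖yᵢ − yⱼ‖) for the points y₁, …, y_k of Y. -/
open Matrix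

/-- The magnitude 𝟙ᵀ ζ_{tY}⁻¹ 𝟙 of a finite subset `Y` of a metric space, with the
metric scaled by `t`, where ζ_{tY}(i,j) = exp(−t·d(yᵢ,yⱼ)). -/
noncomputable def finsetMagnitude {E : Type*} [MetricSpace E] (t : ℝ) (Y : Finset E) : ℝ :=
  letI : DecidableEq E := Classical.decEq E
  dotProduct (fun _ : ↥Y => (1 : ℝ))
    ((Matrix.of fun i j : ↥Y => Real.exp (-(t * dist (i : E) (j : E))))⁻¹ *ᵥ
      fun _ : ↥Y => (1 : ℝ))

/-- The magnitude of an arbitrary subset `X` of a metric space (scaled by `t`), defined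
as the supremum of the magnitudes of finite subsets of `X`. -/
noncomputable def setMagnitude {E : Type*} [MetricSpace E] (t : ℝ) (X : Set E) : ℝ :=
  sSup { r : ℝ | ∃ Y : Finset E, ↑Y ⊆ X ∧ r = finsetMagnitude t Y }

open MeasureTheory

theorem alternating_sum_nonneg {c : ℕ → ℝ} {l : ℝ} (hc : Antitone c)
    (hl : HasSum (fun k => (-1) ^ k * c k) l) : 0 ≤ l := by
  simpa using hc.alternating_series_le_tendsto hl.tendsto_sum_nat 0

theorem sum_mul_triangle_nonneg {ι : Type*} [Fintype ι] (w p : ι → ℝ) (s : ℝ) :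
    0 ≤ ∑ i, ∑ j, w i * w j * max (s - |p i - p j|) 0 := by
  have key : ∀ i j, max (s - |p i - p j|) 0 =
      ∫ z, (Set.Icc (p i) (p i + s)).indicator (fun _ => (1 : ℝ)) z *
        (Set.Icc (p j) (p j + s)).indicator (fun _ => (1 : ℝ)) z := by
    intro i j
    have h : (fun z => (Set.Icc (p i) (p i + s)).indicator (fun _ => (1 : ℝ)) z *
        (Set.Icc (p j) (p j + s)).indicator (fun _ => (1 : ℝ)) z) =
        (Set.Icc (max (p i) (p j)) (min (p i + s) (p j + s))).indicator (fun _ => (1 : ℝ)) := by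
      rw [← Set.Icc_inter_Icc]
      ext z
      simp [Set.indicator, ite_and]
      split_ifs <;> simp_all
    rw [h, integral_indicator measurableSet_Icc]
    simp only [integral_const, smul_eq_mul, mul_one, measureReal_restrict_apply_univ]
    rw [Measure.real, Real.volume_Icc, ENNReal.toReal_ofReal']
    congr 1
    rw [min_add_add_right]
    rcases le_total (p i) (p j) with h | h
    · rw [min_eq_left h, max_eq_right h, abs_of_nonpos (by linarith)]; ring
    · rw [min_eq_right h, max_eq_left h, abs_of_nonneg (by linarith)]; ring
  have hint : ∀ i j, Integrable (fun z => (Set.Icc (p i) (p i + s)).indicator (fun _ => (1 : ℝ)) z *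
        (Set.Icc (p j) (p j + s)).indicator (fun _ => (1 : ℝ)) z) := by
    intro i j
    have hI : ∀ a b : ℝ, Integrable ((Set.Icc a b).indicator (fun _ => (1 : ℝ))) := fun a b =>
      (integrable_indicator_iff measurableSet_Icc).2 (by simp)
    refine (hI (p j) (p j + s)).bdd_mul (c := 1) (hI (p i) (p i + s)).aestronglyMeasurable ?_
    refine Filter.Eventually.of_forall fun z => ?_
    by_cases hz : z ∈ Set.Icc (p i) (p i + s) <;> simp [Set.indicator, hz]
  simp_rw [key, ← integral_const_mul]
  rw [← Finset.sum_congr rfl fun i _ => integral_finsetSum _ fun j _ => (hint i j).const_mul _,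
    ← integral_finsetSum _ fun i _ => integrable_finsetSum _ fun j _ => (hint i j).const_mul _]
  refine integral_nonneg fun z => ?_
  have : ∑ i, ∑ j, w i * w j * ((Set.Icc (p i) (p i + s)).indicator (fun _ => (1 : ℝ)) z *
      (Set.Icc (p j) (p j + s)).indicator (fun _ => (1 : ℝ)) z) =
      (∑ i, w i * (Set.Icc (p i) (p i + s)).indicator (fun _ => (1 : ℝ)) z) ^ 2 := by
    rw [sq, Finset.sum_mul_sum]
    exact Finset.sum_congr rfl fun i _ => Finset.sum_congr rfl fun j _ => by ring
  simp only [this, Pi.zero_apply]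
  positivity

theorem sum_mul_integral_triangle_nonneg {ι : Type*} [Fintype ι] (w p : ι → ℝ) {L : ℝ}
    (hL : 0 ≤ L) {g : ℝ → ℝ} (hg : Continuous g) (hg0 : ∀ s ∈ Set.Icc 0 L, 0 ≤ g s) :
    0 ≤ ∑ i, ∑ j, w i * w j * ∫ s in (0 : ℝ)..L, max (s - |p i - p j|) 0 * g s := by
  have hint : ∀ i j, IntervalIntegrable
      (fun s => w i * w j * (max (s - |p i - p j|) 0 * g s)) volume 0 L := fun i j =>
    Continuous.intervalIntegrable (by fun_prop) _ _
  simp_rw [← intervalIntegral.integral_const_mul]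
  rw [← Finset.sum_congr rfl fun i _ => intervalIntegral.integral_finsetSum fun j _ => hint i j,
    ← intervalIntegral.integral_finsetSum fun i _ =>
      Continuous.intervalIntegrable (by fun_prop) _ _]
  refine intervalIntegral.integral_nonneg hL fun s hs => ?_
  have : ∑ i, ∑ j, w i * w j * (max (s - |p i - p j|) 0 * g s) =
      g s * ∑ i, ∑ j, w i * w j * max (s - |p i - p j|) 0 := by
    simp_rw [Finset.mul_sum]
    exact Finset.sum_congr rfl fun i _ => Finset.sum_congr rfl fun j _ => by ring
  rw [this]
  exact mul_nonneg (hg0 s hs) (sum_mul_triangle_nonneg w p s)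

/-- The second-order Taylor remainder of `r ^ (k + 2)` at `L`. -/
def powRemainder (L : ℝ) (k : ℕ) (r : ℝ) : ℝ :=
  r ^ (k + 2) - L ^ (k + 2) + (k + 2) * L ^ (k + 1) * (L - r)

theorem integral_triangle_mul_pow {r L : ℝ} (hr : 0 ≤ r) (hrL : r ≤ L) (k : ℕ) :
    ∫ s in (0 : ℝ)..L, max (s - r) 0 * (((k : ℝ) + 2) * (k + 1) * s ^ k) =
      powRemainder L k r := by
  have hc : Continuous fun s => max (s - r) 0 * (((k : ℝ) + 2) * (k + 1) * s ^ k) := by fun_prop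
  rw [← intervalIntegral.integral_add_adjacent_intervals (hc.intervalIntegrable 0 r)
    (hc.intervalIntegrable r L)]
  have h1 : ∫ s in (0 : ℝ)..r, max (s - r) 0 * (((k : ℝ) + 2) * (k + 1) * s ^ k) = 0 := by
    rw [intervalIntegral.integral_congr (g := fun _ => (0 : ℝ))]
    · simp
    · intro s hs
      rw [Set.uIcc_of_le hr] at hs
      simp [max_eq_right (sub_nonpos.2 hs.2)]
  have h2 : ∫ s in r..L, max (s - r) 0 * (((k : ℝ) + 2) * (k + 1) * s ^ k) =
      ∫ s in r..L, (((k : ℝ) + 1) * (((k + 1 : ℕ) + 1 : ℝ) * s ^ (k + 1)) -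
        r * (k + 2) * (((k : ℝ) + 1) * s ^ k)) := by
    refine intervalIntegral.integral_congr fun s hs => ?_
    rw [Set.uIcc_of_le hrL] at hs
    simp only [max_eq_left (sub_nonneg.2 hs.1)]
    push_cast
    ring
  rw [h1, h2, intervalIntegral.integral_sub (Continuous.intervalIntegrable (by fun_prop) _ _)
    (Continuous.intervalIntegrable (by fun_prop) _ _)]
  simp only [intervalIntegral.integral_const_mul, integral_pow, powRemainder]
  push_cast
  field_simp
  ring

section Line

variable {ι : Type*} [Fintype ι] (w p : ι → ℝ) {L : ℝ}

theorem sum_mul_sub_nonneg (hp : ∀ i j, |p i - p j| ≤ L) :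
    0 ≤ ∑ i, ∑ j, w i * w j * (L - |p i - p j|) := by
  have h := sum_mul_triangle_nonneg w p L
  simpa only [max_eq_left (sub_nonneg.2 (hp _ _))] using h

theorem sum_mul_powRemainder_nonneg (hL : 0 ≤ L) (hp : ∀ i j, |p i - p j| ≤ L) (k : ℕ) :
    0 ≤ ∑ i, ∑ j, w i * w j * powRemainder L k |p i - p j| := by
  have h := sum_mul_integral_triangle_nonneg w p hL
    (g := fun s => ((k : ℝ) + 2) * (k + 1) * s ^ k) (by fun_prop)
    (fun s hs => by have := hs.1; positivity)
  simpa only [integral_triangle_mul_pow (abs_nonneg _) (hp _ _)] using h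

theorem sum_mul_powRemainder_succ_le (hL : 0 ≤ L) (hp : ∀ i j, |p i - p j| ≤ L) (k : ℕ) :
    0 ≤ ∑ i, ∑ j, w i * w j * (((k : ℝ) + 3) * L * powRemainder L k |p i - p j| -
      (k + 1) * powRemainder L (k + 1) |p i - p j|) := by
  have h := sum_mul_integral_triangle_nonneg w p hL
    (g := fun s => ((k : ℝ) + 3) * L * (((k : ℝ) + 2) * (k + 1) * s ^ k) -
      (k + 1) * (((k + 1 : ℕ) + 2 : ℝ) * ((k + 1 : ℕ) + 1) * s ^ (k + 1))) (by fun_prop)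
    (fun s hs => by
      have h0 := hs.1
      have h1 := sub_nonneg.2 hs.2
      have : 0 ≤ ((k : ℝ) + 3) * (k + 2) * (k + 1) * s ^ k * (L - s) := by positivity
      push_cast
      convert this using 1
      ring)
  have key : ∀ i j, ∫ s in (0 : ℝ)..L, max (s - |p i - p j|) 0 *
      (((k : ℝ) + 3) * L * (((k : ℝ) + 2) * (k + 1) * s ^ k) -
      (k + 1) * (((k + 1 : ℕ) + 2 : ℝ) * ((k + 1 : ℕ) + 1) * s ^ (k + 1))) =
      ((k : ℝ) + 3) * L * powRemainder L k |p i - p j| -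
      (k + 1) * powRemainder L (k + 1) |p i - p j| := by
    intro i j
    rw [← integral_triangle_mul_pow (abs_nonneg _) (hp i j),
      ← integral_triangle_mul_pow (abs_nonneg _) (hp i j),
      ← intervalIntegral.integral_const_mul, ← intervalIntegral.integral_const_mul,
      ← intervalIntegral.integral_sub (Continuous.intervalIntegrable (by fun_prop) _ _)
        (Continuous.intervalIntegrable (by fun_prop) _ _)]
    exact intervalIntegral.integral_congr fun s _ => by ring
  simpa only [key] using h

end Line

theorem alternating_moment_lower_bound {b S : ℕ → ℝ} {L q Q : ℝ} (hL : 0 ≤ L)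
    (hqL : q * L ≤ 1 / 2) (hb : ∀ k, 0 ≤ b k) (hbr : ∀ k : ℕ, (k + 1) * b (k + 1) ≤ q * b k)
    (hS0 : 0 ≤ S 0) (hT : 0 ≤ L * S 0 - S 1)
    (hH : ∀ k : ℕ, 0 ≤ S (k + 2) - L ^ (k + 2) * S 0 +
      (k + 2) * L ^ (k + 1) * (L * S 0 - S 1))
    (hHr : ∀ k : ℕ, ((k : ℝ) + 1) * (S (k + 3) - L ^ (k + 3) * S 0 +
      (k + 3) * L ^ (k + 2) * (L * S 0 - S 1)) ≤
      (k + 3) * L * (S (k + 2) - L ^ (k + 2) * S 0 + (k + 2) * L ^ (k + 1) * (L * S 0 - S 1)))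
    (hQ : HasSum (fun k => (-1) ^ k * (b k * S k)) Q) :
    (b 0 - b 1 * L) * S 0 ≤ Q := by
  set T := L * S 0 - S 1 with hTdef
  set e : ℕ → ℝ := fun k => (k + 1) * b (k + 1) * L ^ k * T with he
  set d : ℕ → ℝ := fun k => b (k + 2) * (S (k + 2) + (k + 2) * L ^ (k + 1) * T) with hd
  have he0 : ∀ k, 0 ≤ e k := fun k => by have := hb (k + 1); positivity
  have her : ∀ k, e (k + 1) ≤ 1 / 2 * e k := by
    intro k
    have h1 := hbr (k + 1)
    have h2 := hb (k + 1)
    have h3 : 0 ≤ L ^ k * T := by positivity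
    have h4 : ((k + 1 : ℕ) + 1 : ℝ) * b (k + 1 + 1) * L ≤ 1 / 2 * ((k + 1) * b (k + 1)) :=
      calc ((k + 1 : ℕ) + 1 : ℝ) * b (k + 1 + 1) * L ≤ q * b (k + 1) * L := by gcongr
        _ = q * L * b (k + 1) := by ring
        _ ≤ 1 / 2 * b (k + 1) := by gcongr
        _ ≤ 1 / 2 * ((k + 1) * b (k + 1)) := by
          gcongr
          nlinarith [(Nat.cast_nonneg k : (0 : ℝ) ≤ k)]
    calc e (k + 1) = ((k + 1 : ℕ) + 1 : ℝ) * b (k + 1 + 1) * L * (L ^ k * T) := by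
          simp only [he]; ring
      _ ≤ 1 / 2 * ((k + 1) * b (k + 1)) * (L ^ k * T) := by gcongr
      _ = 1 / 2 * e k := by simp only [he]; ring
  have hes : Summable e := by
    refine summable_of_ratio_norm_eventually_le (r := 1 / 2) (by norm_num)
      (Filter.Eventually.of_forall fun k => ?_)
    rw [Real.norm_of_nonneg (he0 _), Real.norm_of_nonneg (he0 _)]
    exact her k
  have hes' : Summable fun k => (-1) ^ k * e k := by
    refine Summable.of_norm ?_
    simpa [abs_mul] using hes.abs
  have hA : 0 ≤ ∑' k, (-1) ^ k * e k :=
    alternating_sum_nonneg (antitone_nat_of_succ_le fun k => by linarith [her k, he0 k])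
      hes'.hasSum
  have hd_anti : Antitone d := by
    refine antitone_nat_of_succ_le fun k => ?_
    have h1 := hb (k + 2)
    have h1' := hb (k + 3)
    have h2 := hbr (k + 2)
    have h3 := hH k
    have h3' := hH (k + 1)
    have h4 := hHr k
    set H := S (k + 2) - L ^ (k + 2) * S 0 + (k + 2) * L ^ (k + 1) * T with hHdef
    set H' := S (k + 3) - L ^ (k + 3) * S 0 + (k + 3) * L ^ (k + 2) * T with hHdef'
    have hk : (0 : ℝ) ≤ k := Nat.cast_nonneg k
    push_cast at h2
    have hq : ((k : ℝ) + 3) * b (k + 3) * L ≤ b (k + 2) :=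
      calc ((k : ℝ) + 3) * b (k + 3) * L = ((k : ℝ) + 2 + 1) * b (k + 2 + 1) * L := by ring
        _ ≤ q * b (k + 2) * L := by gcongr
        _ = q * L * b (k + 2) := by ring
        _ ≤ 1 / 2 * b (k + 2) := by gcongr
        _ ≤ b (k + 2) := by linarith
    have hHH : b (k + 3) * H' ≤ b (k + 2) * H := by
      have : (k + 1) * (b (k + 3) * H') ≤ (k + 1) * (b (k + 2) * H) :=
        calc (k + 1) * (b (k + 3) * H') = b (k + 3) * ((k + 1) * H') := by ring
          _ ≤ b (k + 3) * ((k + 3) * L * H) := by gcongr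
          _ = ((k : ℝ) + 3) * b (k + 3) * L * H := by ring
          _ ≤ b (k + 2) * H := by gcongr
          _ ≤ (k + 1) * (b (k + 2) * H) := by nlinarith [mul_nonneg h1 h3]
      exact le_of_mul_le_mul_left this (by positivity)
    have hLL : b (k + 3) * L ^ (k + 3) * S 0 ≤ b (k + 2) * L ^ (k + 2) * S 0 := by
      have h5 : b (k + 3) * L ≤ b (k + 2) := by
        nlinarith [mul_nonneg h1' hL, mul_nonneg hk (mul_nonneg h1' hL)]
      calc b (k + 3) * L ^ (k + 3) * S 0 = b (k + 3) * L * L ^ (k + 2) * S 0 := by ring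
        _ ≤ b (k + 2) * L ^ (k + 2) * S 0 := by gcongr
    have e1 : d (k + 1) = b (k + 3) * H' + b (k + 3) * L ^ (k + 3) * S 0 := by
      simp only [hd, hHdef']; push_cast; ring
    have e2 : d k = b (k + 2) * H + b (k + 2) * L ^ (k + 2) * S 0 := by
      simp only [hd, hHdef]; ring
    rw [e1, e2]
    exact add_le_add hHH hLL
  have hQ2 : HasSum (fun k => (-1) ^ k * (b (k + 2) * S (k + 2))) (Q - (b 0 * S 0 - b 1 * S 1)) := by
    have := (hasSum_nat_add_iff' 2).2 hQ
    simpa [Finset.sum_range_succ, pow_add, sub_eq_add_neg] using this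
  have he2 : HasSum (fun k => (-1) ^ k * e (k + 1)) (-((∑' k, (-1) ^ k * e k) - e 0)) := by
    have := ((hasSum_nat_add_iff' 1).2 hes'.hasSum).neg
    simpa [pow_add] using this
  have hD : HasSum (fun k => (-1) ^ k * d k)
      (Q - (b 0 * S 0 - b 1 * S 1) + -((∑' k, (-1) ^ k * e k) - e 0)) := by
    convert hQ2.add he2 using 2 with k
    simp only [hd, he]
    push_cast
    ring
  have hD0 := alternating_sum_nonneg hd_anti hD
  have he00 : e 0 = b 1 * T := by simp [he]
  rw [he00, hTdef] at hD0
  nlinarith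

section Ball

variable {E : Type*} [NormedAddCommGroup E] [InnerProductSpace ℝ E] [FiniteDimensional ℝ E]
  [MeasurableSpace E] [BorelSpace E]

/-- The `k`-th absolute moment, over the unit ball, of the component along `x`. -/
noncomputable def ballMoment (x : E) (k : ℕ) : ℝ :=
  ∫ u in Metric.closedBall (0 : E) 1, |inner ℝ x u| ^ k

theorem integrableOn_ball {f : E → ℝ} (hf : Continuous f) :
    IntegrableOn f (Metric.closedBall (0 : E) 1) :=
  hf.continuousOn.integrableOn_compact (isCompact_closedBall _ _)

theorem ballMoment_eq_of_norm_eq {x y : E} (h : ‖x‖ = ‖y‖) (k : ℕ) :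
    ballMoment x k = ballMoment y k := by
  let φ : E ≃ₗᵢ[ℝ] E := (ℝ ∙ (x - y))ᗮ.reflection
  have hφ : φ x = y := Submodule.reflection_sub h
  have hpre : φ ⁻¹' Metric.closedBall (0 : E) 1 = Metric.closedBall 0 1 := by
    ext u; simp
  have := φ.measurePreserving.setIntegral_preimage_emb
    φ.toHomeomorph.measurableEmbedding (fun u => |inner ℝ y u| ^ k) (Metric.closedBall 0 1)
  rw [hpre] at this
  rw [ballMoment, ballMoment, ← this, ← hφ]
  simp

theorem ballMoment_eq {e : E} (he : ‖e‖ = 1) (x : E) (k : ℕ) :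
    ballMoment x k = ‖x‖ ^ k * ballMoment e k := by
  rw [ballMoment_eq_of_norm_eq (y := ‖x‖ • e) (by simp [norm_smul, he]), ballMoment, ballMoment,
    ← integral_const_mul]
  simp [inner_smul_left, abs_mul, mul_pow]

theorem ballMoment_pos {e : E} (he : ‖e‖ = 1) (k : ℕ) : 0 < ballMoment e k := by
  have hc : Continuous fun u : E => |inner ℝ e u| ^ k := by fun_prop
  rw [ballMoment, setIntegral_pos_iff_support_of_nonneg_ae
    (Filter.Eventually.of_forall fun u => by positivity) (integrableOn_ball hc)]
  refine lt_of_lt_of_le ?_ (measure_mono (Set.inter_subset_inter_right _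
    Metric.ball_subset_closedBall))
  refine (hc.isOpen_support.inter Metric.isOpen_ball).measure_pos _ ⟨(1 / 2 : ℝ) • e, ?_, ?_⟩
  · simp [inner_smul_right, he]
  · simp [norm_smul, he]; norm_num

theorem ballMoment_mul_le {e : E} (he : ‖e‖ = 1) (k : ℕ) :
    ballMoment e 1 / ballMoment e 0 * ballMoment e k ≤ ballMoment e (k + 1) := by
  have h0 := ballMoment_pos he 0
  have h1 := ballMoment_pos he 1
  set c := ballMoment e 1 / ballMoment e 0 with hc
  have hc0 : 0 ≤ c := by positivity
  have hi : ∀ k, IntegrableOn (fun u : E => |inner ℝ e u| ^ k) (Metric.closedBall (0 : E) 1) :=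
    fun k => integrableOn_ball (by fun_prop)
  have key : 0 ≤ ∫ u in Metric.closedBall (0 : E) 1,
      (|inner ℝ e u| ^ (k + 1) - c * |inner ℝ e u| ^ k -
        (c ^ k * |inner ℝ e u| ^ 1 - c ^ (k + 1) * |inner ℝ e u| ^ 0)) := by
    refine integral_nonneg fun u => ?_
    have hv := abs_nonneg (inner ℝ e u)
    set v := |inner ℝ e u|
    have : 0 ≤ (v - c) * (v ^ k - c ^ k) := by
      rcases le_total v c with h | h
      · exact mul_nonneg_of_nonpos_of_nonpos (by linarith)
          (sub_nonpos.2 (pow_le_pow_left₀ hv h k))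
      · exact mul_nonneg (by linarith) (sub_nonneg.2 (pow_le_pow_left₀ hc0 h k))
    calc (0 : ℝ) ≤ (v - c) * (v ^ k - c ^ k) := this
      _ = _ := by ring
  rw [integral_sub (integrableOn_ball (by fun_prop)) (integrableOn_ball (by fun_prop)),
    integral_sub (hi _) ((hi _).const_mul _),
    integral_sub ((hi _).const_mul _) ((hi _).const_mul _)] at key
  simp only [integral_const_mul] at key
  change 0 ≤ ballMoment e (k + 1) - c * ballMoment e k -
    (c ^ k * ballMoment e 1 - c ^ (k + 1) * ballMoment e 0) at key
  have : c * ballMoment e 0 = ballMoment e 1 := by rw [hc]; field_simp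
  rw [pow_succ, mul_assoc, this] at key
  linarith

variable {ι : Type*} [Fintype ι] (w : ι → ℝ) (x : ι → E) {L : ℝ}

theorem sum_mul_exp_lower_bound {e : E} (he : ‖e‖ = 1) (hL : 0 ≤ L)
    (hx : ∀ i j, dist (x i) (x j) ≤ L) {t : ℝ} (ht : 0 < t)
    (htL : t * (ballMoment e 0 / ballMoment e 1) * L ≤ 1 / 2) :
    (1 - t * (ballMoment e 0 / ballMoment e 1) * L) * (∑ i, w i) ^ 2 ≤
      ∑ i, ∑ j, w i * w j * Real.exp (-(t * dist (x i) (x j))) := by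
  set m := ballMoment e with hm
  have hmpos : ∀ k, 0 < m k := ballMoment_pos he
  let F : ℕ → E → ℝ := fun k u => ∑ i, ∑ j, w i * w j * |inner ℝ (x i) u - inner ℝ (x j) u| ^ k
  let S : ℕ → ℝ := fun k => m k * ∑ i, ∑ j, w i * w j * dist (x i) (x j) ^ k
  have hFc : ∀ k, Continuous (F k) := fun k => by fun_prop
  have hFi : ∀ k, IntegrableOn (F k) (Metric.closedBall (0 : E) 1) :=
    fun k => integrableOn_ball (hFc k)
  have hFS : ∀ k, ∫ u in Metric.closedBall (0 : E) 1, F k u = S k := by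
    intro k
    have hterm : ∀ i j, ∫ u in Metric.closedBall (0 : E) 1,
        w i * w j * |inner ℝ (x i) u - inner ℝ (x j) u| ^ k =
        m k * (w i * w j * dist (x i) (x j) ^ k) := by
      intro i j
      have := ballMoment_eq he (x i - x j) k
      rw [ballMoment] at this
      simp only [inner_sub_left] at this
      rw [integral_const_mul, this, dist_eq_norm]
      ring
    simp only [F, S, Finset.mul_sum, ← hterm]
    rw [integral_finsetSum _ fun i _ => integrableOn_ball (by fun_prop)]
    exact Finset.sum_congr rfl fun i _ =>
      integral_finsetSum _ fun j _ => integrableOn_ball (by fun_prop)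
  have hp : ∀ u ∈ Metric.closedBall (0 : E) 1, ∀ i j,
      |inner ℝ (x i) u - inner ℝ (x j) u| ≤ L := by
    intro u hu i j
    rw [← inner_sub_left]
    refine (abs_real_inner_le_norm _ _).trans ?_
    have h1 : ‖x i - x j‖ ≤ L := by rw [← dist_eq_norm]; exact hx i j
    have h2 : ‖u‖ ≤ 1 := by simpa using hu
    nlinarith [norm_nonneg u]
  have hT : 0 ≤ L * S 0 - S 1 := by
    rw [← hFS, ← hFS, ← integral_const_mul, ← integral_sub ((hFi 0).const_mul L) (hFi 1)]
    refine setIntegral_nonneg Metric.isClosed_closedBall.measurableSet fun u hu => ?_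
    convert sum_mul_sub_nonneg w _ (hp u hu) using 1
    simp only [F, Finset.mul_sum, ← Finset.sum_sub_distrib]
    exact Finset.sum_congr rfl fun i _ => Finset.sum_congr rfl fun j _ => by ring
  have hcomb : ∀ k : ℕ, ∫ u in Metric.closedBall (0 : E) 1,
      (F (k + 2) u - L ^ (k + 2) * F 0 u + (k + 2) * L ^ (k + 1) * (L * F 0 u - F 1 u)) =
      S (k + 2) - L ^ (k + 2) * S 0 + (k + 2) * L ^ (k + 1) * (L * S 0 - S 1) := by
    intro k
    rw [integral_add (integrableOn_ball (by fun_prop)) (integrableOn_ball (by fun_prop)),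
      integral_sub (hFi _) ((hFi _).const_mul _), integral_const_mul, integral_const_mul,
      integral_sub ((hFi _).const_mul _) (hFi _), integral_const_mul]
    simp only [hFS]
  have hcombF : ∀ (k : ℕ) u, F (k + 2) u - L ^ (k + 2) * F 0 u +
      (k + 2) * L ^ (k + 1) * (L * F 0 u - F 1 u) =
      ∑ i, ∑ j, w i * w j * powRemainder L k |inner ℝ (x i) u - inner ℝ (x j) u| := by
    intro k u
    simp only [F, powRemainder, Finset.mul_sum, ← Finset.sum_sub_distrib,
      ← Finset.sum_add_distrib]
    exact Finset.sum_congr rfl fun i _ => Finset.sum_congr rfl fun j _ => by ring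
  have hH : ∀ k : ℕ, 0 ≤ S (k + 2) - L ^ (k + 2) * S 0 +
      (k + 2) * L ^ (k + 1) * (L * S 0 - S 1) := by
    intro k
    rw [← hcomb]
    refine setIntegral_nonneg Metric.isClosed_closedBall.measurableSet fun u hu => ?_
    rw [hcombF]
    exact sum_mul_powRemainder_nonneg w _ hL (hp u hu) k
  have hHr : ∀ k : ℕ, ((k : ℝ) + 1) * (S (k + 3) - L ^ (k + 3) * S 0 +
      (k + 3) * L ^ (k + 2) * (L * S 0 - S 1)) ≤
      (k + 3) * L * (S (k + 2) - L ^ (k + 2) * S 0 +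
        (k + 2) * L ^ (k + 1) * (L * S 0 - S 1)) := by
    intro k
    have h1 := hcomb (k + 1)
    have h2 : S (k + 3) - L ^ (k + 3) * S 0 + (k + 3) * L ^ (k + 2) * (L * S 0 - S 1) =
      S (k + 1 + 2) - L ^ (k + 1 + 2) * S 0 +
        ((k + 1 : ℕ) + 2) * L ^ (k + 1 + 1) * (L * S 0 - S 1) := by push_cast; ring
    rw [h2, ← h1, ← hcomb k, ← integral_const_mul, ← integral_const_mul]
    refine setIntegral_mono_on (integrableOn_ball (by fun_prop)) (integrableOn_ball (by fun_prop))
      Metric.isClosed_closedBall.measurableSet fun u hu => ?_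
    rw [hcombF, hcombF, ← sub_nonneg]
    refine (sum_mul_powRemainder_succ_le w _ hL (hp u hu) k).trans_eq ?_
    simp only [Finset.mul_sum, ← Finset.sum_sub_distrib]
    exact Finset.sum_congr rfl fun i _ => Finset.sum_congr rfl fun j _ => by ring
  have hW : ∑ i, ∑ j, w i * w j = (∑ i, w i) ^ 2 := by rw [sq, Finset.sum_mul_sum]
  have hS0 : S 0 = m 0 * (∑ i, w i) ^ 2 := by simp [S, hW]
  let b : ℕ → ℝ := fun k => t ^ k / (k.factorial * m k)
  have hb : ∀ k, 0 ≤ b k := fun k => by have := hmpos k; positivity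
  have hbr : ∀ k : ℕ, (k + 1) * b (k + 1) ≤ t * (m 0 / m 1) * b k := by
    intro k
    have h := ballMoment_mul_le he k
    rw [← hm] at h
    have h0 := hmpos 0
    have h1 := hmpos 1
    have hk := hmpos k
    have hk1 := hmpos (k + 1)
    have h' : m 1 * m k ≤ m 0 * m (k + 1) := by
      rw [div_mul_eq_mul_div, div_le_iff₀ h0] at h
      linarith
    have e1 : (k + 1) * b (k + 1) = t ^ (k + 1) / k.factorial * (1 / m (k + 1)) := by
      simp only [b, Nat.factorial_succ]
      push_cast
      field_simp
    have e2 : t * (m 0 / m 1) * b k = t ^ (k + 1) / k.factorial * (m 0 / (m 1 * m k)) := by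
      simp only [b]
      field_simp
      ring
    rw [e1, e2]
    gcongr ?_ * ?_
    rw [div_le_div_iff₀ hk1 (by positivity)]
    linarith
  have hQ : HasSum (fun k => (-1) ^ k * (b k * S k))
      (∑ i, ∑ j, w i * w j * Real.exp (-(t * dist (x i) (x j)))) := by
    have : ∀ k, (-1) ^ k * (b k * S k) =
        ∑ i, ∑ j, w i * w j * ((-(t * dist (x i) (x j))) ^ k / k.factorial) := by
      intro k
      have hk := (hmpos k).ne'
      simp only [b, S, Finset.mul_sum]
      refine Finset.sum_congr rfl fun i _ => Finset.sum_congr rfl fun j _ => ?_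
      rw [neg_pow (t * _), mul_pow]
      field_simp
    simp only [this]
    refine hasSum_sum fun i _ => hasSum_sum fun j _ => HasSum.mul_left _ ?_
    rw [Real.exp_eq_exp_ℝ]
    exact NormedSpace.expSeries_div_hasSum_exp _
  have main := alternating_moment_lower_bound hL htL hb hbr
    (by rw [hS0]; have := hmpos 0; positivity) hT hH hHr hQ
  refine le_trans (le_of_eq ?_) main
  have h0 := hmpos 0
  have h1 := hmpos 1
  rw [hS0]
  simp only [b]
  field_simp
  simp [mul_comm]

end Ball

theorem exists_sum_mul_exp_lower_bound {E : Type*} [NormedAddCommGroup E] [InnerProductSpace ℝ E]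
    [FiniteDimensional ℝ E] {L : ℝ} (hL : 0 ≤ L) :
    ∃ C : ℝ, ∀ t : ℝ, 0 < t → t * C ≤ 1 / 2 → ∀ Y : Finset E,
      (∀ x ∈ Y, ∀ y ∈ Y, dist x y ≤ L) → ∀ w : Y → ℝ,
      (1 - t * C) * (∑ i, w i) ^ 2 ≤
        ∑ i, ∑ j, w i * w j * Real.exp (-(t * dist (i : E) (j : E))) := by
  borelize E
  rcases subsingleton_or_nontrivial E with hE | hE
  · refine ⟨0, fun t _ _ Y _ w => le_of_eq ?_⟩
    have h0 : ∀ i j : Y, dist (i : E) (j : E) = 0 := fun i j => by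
      rw [Subsingleton.elim (i : E) (j : E), dist_self]
    simp [h0, sq, Finset.sum_mul_sum]
  · obtain ⟨e, he⟩ := exists_norm_eq E zero_le_one
    refine ⟨ballMoment e 0 / ballMoment e 1 * L, fun t ht htC Y hY w => ?_⟩
    rw [← mul_assoc] at htC ⊢
    exact sum_mul_exp_lower_bound w (fun i : Y => (i : E)) he hL
      (fun i j => hY i i.2 j j.2) ht htC

theorem finsetMagnitude_le {E : Type*} [MetricSpace E] {t a : ℝ} (ha : 0 < a) {Y : Finset E}
    (hY : ∀ w : Y → ℝ, a * (∑ i, w i) ^ 2 ≤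
      ∑ i, ∑ j, w i * w j * Real.exp (-(t * dist (i : E) (j : E)))) :
    finsetMagnitude t Y ≤ a⁻¹ := by
  let : DecidableEq E := Classical.decEq E
  set A : Matrix Y Y ℝ := Matrix.of fun i j : Y => Real.exp (-(t * dist (i : E) (j : E))) with hA
  set v : Y → ℝ := A⁻¹ *ᵥ fun _ => 1 with hv
  have hmag : finsetMagnitude t Y = ∑ i, v i := by
    change dotProduct (fun _ => (1 : ℝ)) v = _
    simp [dotProduct]
  rw [hmag]
  by_cases hdet : IsUnit A.det
  · have hAv : A *ᵥ v = fun _ => 1 := by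
      rw [hv, mulVec_mulVec, mul_nonsing_inv _ hdet, one_mulVec]
    have hsum : ∑ i, ∑ j, v i * v j * Real.exp (-(t * dist (i : E) (j : E))) = ∑ i, v i := by
      refine Finset.sum_congr rfl fun i _ => ?_
      have h := congrFun hAv i
      simp only [mulVec, dotProduct, hA, of_apply] at h
      calc ∑ j : Y, v i * v j * Real.exp (-(t * dist (i : E) (j : E)))
          = v i * ∑ j : Y, Real.exp (-(t * dist (i : E) (j : E))) * v j := by
            rw [Finset.mul_sum]
            exact Finset.sum_congr rfl fun j _ => by ring
        _ = v i := by rw [h, mul_one]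
    have h := hY v
    rw [hsum] at h
    rcases le_or_gt (∑ i, v i) 0 with h0 | h0
    · exact h0.trans (inv_nonneg.2 ha.le)
    · rw [← one_div, le_div_iff₀ ha]
      nlinarith
  · simp [hv, nonsing_inv_apply_not_isUnit _ hdet, ha.le]

theorem finsetMagnitude_singleton {E : Type*} [MetricSpace E] (t : ℝ) (x : E) :
    finsetMagnitude t {x} = 1 := by
  let : DecidableEq E := Classical.decEq E
  have h : (Matrix.of fun i j : ↥({x} : Finset E) =>
      Real.exp (-(t * dist (i : E) (j : E)))) = 1 := by
    ext i j
    rw [Subsingleton.elim i j]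
    simp
  change dotProduct (fun _ => (1 : ℝ)) ((Matrix.of fun i j : ↥({x} : Finset E) =>
    Real.exp (-(t * dist (i : E) (j : E))))⁻¹ *ᵥ fun _ => 1) = 1
  rw [h, inv_one, one_mulVec]
  simp [dotProduct]

/-- For X ⊆ ℝⁿ nonempty and compact, Mag(tX) → 1 as t → 0⁺. -/
theorem magnitude_tendsto_one {n : ℕ} (X : Set (EuclideanSpace ℝ (Fin n)))
    (hne : X.Nonempty) (hcpt : IsCompact X) :
    Filter.Tendsto (fun t : ℝ => setMagnitude t X) (nhdsWithin 0 (Set.Ioi 0)) (nhds 1) := by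
  obtain ⟨C, hC⟩ := exists_sum_mul_exp_lower_bound (E := EuclideanSpace ℝ (Fin n))
    (L := Metric.diam X) Metric.diam_nonneg
  obtain ⟨x₀, hx₀⟩ := hne
  have hlim : Filter.Tendsto (fun t : ℝ => (1 - t * C)) (nhdsWithin 0 (Set.Ioi 0)) (nhds 1) := by
    have : Continuous fun t : ℝ => 1 - t * C := by fun_prop
    simpa using (this.tendsto 0).mono_left nhdsWithin_le_nhds
  have hinv : Filter.Tendsto (fun t : ℝ => (1 - t * C)⁻¹) (nhdsWithin 0 (Set.Ioi 0)) (nhds 1) := by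
    simpa using hlim.inv₀ one_ne_zero
  have hbound : ∀ᶠ t in nhdsWithin (0 : ℝ) (Set.Ioi 0),
      1 ∈ { r : ℝ | ∃ Y : Finset (EuclideanSpace ℝ (Fin n)), ↑Y ⊆ X ∧ r = finsetMagnitude t Y } ∧
      (1 - t * C)⁻¹ ∈ upperBounds { r : ℝ | ∃ Y : Finset (EuclideanSpace ℝ (Fin n)),
        ↑Y ⊆ X ∧ r = finsetMagnitude t Y } := by
    filter_upwards [self_mem_nhdsWithin, hlim.eventually_const_le (by norm_num : (1 / 2 : ℝ) < 1)]
      with t ht htC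
    refine ⟨⟨{x₀}, by simpa using hx₀, (finsetMagnitude_singleton t x₀).symm⟩, ?_⟩
    rintro r ⟨Y, hY, rfl⟩
    exact finsetMagnitude_le (by linarith) (hC t ht (by linarith) Y fun x hx y hy =>
      Metric.dist_le_diam_of_mem hcpt.isBounded (hY hx) (hY hy))
  refine tendsto_of_tendsto_of_tendsto_of_le_of_le' tendsto_const_nhds hinv ?_ ?_
  · filter_upwards [hbound] with t ht
    exact le_csSup ⟨_, ht.2⟩ ht.1
  · filter_upwards [hbound] with t ht
    exact csSup_le ⟨_, ht.1⟩ ht.2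
end

section
/- Let X ⊆ ℝⁿ be nonempty and compact. Then Mag(tX)/tⁿ → Vol(X)/(n!·Vol(Bₙ)) as t → ∞, where Vol denotes n-dimensional Lebesgue measure, Bₙ ⊂ ℝⁿ is the unit ball, and Mag(tX) = sup{ 𝟙ᵀ ζ_{tY}⁻¹ 𝟙 : Y a finite subset of X } with ζ_{tY}(i,j) = exp(−t‖yᵢ − yⱼ‖). -/
open Matrix

section MagnitudeAsymptotics

open MeasureTheory Set Filter Topology
open scoped FourierTransform SchwartzMap

/-- Injectivity of `s ↦ s - c / s` on the positive half-line. -/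
theorem injOn_sub_div_Ioi {c : ℝ} (hc : 0 < c) : InjOn (fun s : ℝ => s - c / s) (Ioi 0) := by
  intro a ha b hb hab
  have ha : 0 < a := ha
  have hb : 0 < b := hb
  simp only at hab
  field_simp at hab
  have : (a - b) * (a * b + c) = 0 := by linarith
  rcases mul_eq_zero.1 this with h | h
  · linarith
  · have := mul_pos ha hb
    linarith

theorem image_sub_div_Ioi {c : ℝ} (hc : 0 < c) : (fun s : ℝ => s - c / s) '' Ioi 0 = univ := by
  refine eq_univ_of_forall fun y => ?_
  have h0 : |y| < √(y ^ 2 + 4 * c) := by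
    rw [← Real.sqrt_sq_eq_abs]
    exact Real.sqrt_lt_sqrt (sq_nonneg y) (by linarith)
  have hs : 0 < y + √(y ^ 2 + 4 * c) := by linarith [neg_abs_le y]
  refine ⟨(y + √(y ^ 2 + 4 * c)) / 2, half_pos hs, ?_⟩
  have hsq := Real.sq_sqrt (show 0 ≤ y ^ 2 + 4 * c by positivity)
  simp only
  field_simp
  nlinarith

theorem image_div_Ioi {c : ℝ} (hc : 0 < c) : (fun s : ℝ => c / s) '' Ioi 0 = Ioi 0 := by
  ext y
  constructor
  · rintro ⟨s, hs, rfl⟩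
    exact div_pos hc hs
  · intro hy
    have hy : 0 < y := hy
    exact ⟨c / y, div_pos hc hy, by field_simp⟩

/-- The Cauchy–Schlömilch transformation of the Gaussian integral. -/
theorem integral_exp_neg_sub_div_sq {c : ℝ} (hc : 0 < c) :
    ∫ s in Ioi (0 : ℝ), Real.exp (-(s - c / s) ^ 2) = √Real.pi / 2 := by
  have hd1 : ∀ s ∈ Ioi (0 : ℝ),
      HasDerivWithinAt (fun s : ℝ => s - c / s) (1 + c / s ^ 2) (Ioi 0) s := by
    intro s hs
    have hs : s ≠ 0 := ne_of_gt hs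
    have h := (hasDerivAt_id s).sub ((hasDerivAt_inv hs).const_mul c)
    refine (h.congr_deriv ?_).hasDerivWithinAt
    field_simp
    ring
  have hd2 : ∀ s ∈ Ioi (0 : ℝ),
      HasDerivWithinAt (fun s : ℝ => c / s) (-(c / s ^ 2)) (Ioi 0) s := by
    intro s hs
    have hs : s ≠ 0 := ne_of_gt hs
    refine (((hasDerivAt_inv hs).const_mul c).congr_deriv ?_).hasDerivWithinAt
    field_simp
  have hg : Integrable (fun y : ℝ => Real.exp (-y ^ 2)) := by
    simpa using integrable_exp_neg_mul_sq one_pos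
  have e1 := integral_image_eq_integral_abs_deriv_smul measurableSet_Ioi hd1
    (injOn_sub_div_Ioi hc) (fun y : ℝ => Real.exp (-y ^ 2))
  have i1 := (integrableOn_image_iff_integrableOn_abs_deriv_smul measurableSet_Ioi hd1
    (injOn_sub_div_Ioi hc) (fun y : ℝ => Real.exp (-y ^ 2))).1 hg.integrableOn
  rw [image_sub_div_Ioi hc, setIntegral_univ] at e1
  have hgi : ∫ y : ℝ, Real.exp (-y ^ 2) = √Real.pi := by
    simpa using integral_gaussian 1
  rw [hgi] at e1
  have hinj : InjOn (fun s : ℝ => c / s) (Ioi 0) := by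
    intro a ha b hb hab
    have ha : 0 < a := ha
    have hb : 0 < b := hb
    simp only at hab
    field_simp at hab
    exact hab.symm
  have e2 := integral_image_eq_integral_abs_deriv_smul measurableSet_Ioi hd2 hinj
    (fun s : ℝ => Real.exp (-(s - c / s) ^ 2))
  rw [image_div_Ioi hc] at e2
  have i3 : IntegrableOn (fun s : ℝ => Real.exp (-(s - c / s) ^ 2)) (Ioi 0) := by
    refine i1.mono' (by fun_prop) ((ae_restrict_mem measurableSet_Ioi).mono fun s hs => ?_)
    have hs : 0 < s := hs
    rw [Real.norm_eq_abs, abs_of_pos (Real.exp_pos _), smul_eq_mul]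
    refine le_mul_of_one_le_left (Real.exp_pos _).le ?_
    rw [abs_of_pos (by positivity)]
    have : 0 < c / s ^ 2 := by positivity
    linarith
  have e3 : ∫ s in Ioi (0 : ℝ), |1 + c / s ^ 2| • Real.exp (-(s - c / s) ^ 2)
      - Real.exp (-(s - c / s) ^ 2) = ∫ s in Ioi (0 : ℝ), Real.exp (-(s - c / s) ^ 2) := by
    rw [e2]
    refine setIntegral_congr_fun measurableSet_Ioi fun s hs => ?_
    have hs : 0 < s := hs
    have h1 : c / s - c / (c / s) = -(s - c / s) := by field_simp; ring
    simp only [smul_eq_mul]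
    rw [h1, neg_sq, abs_neg, abs_of_pos (by positivity), abs_of_pos (by positivity)]
    ring
  rw [integral_sub i1 i3, ← e1] at e3
  linarith

/-- The subordination formula, expressing `exp (-r)` as a mixture of Gaussians in `r`. -/
theorem integral_rpow_mul_exp_neg_sub_sq_div {r : ℝ} (hr : 0 ≤ r) :
    ∫ u in Ioi (0 : ℝ), u ^ (-(1 / 2) : ℝ) * Real.exp (-u - r ^ 2 / (4 * u)) =
      √Real.pi * Real.exp (-r) := by
  rcases hr.eq_or_lt with rfl | hr
  · have h := Real.integral_rpow_mul_exp_neg_mul_Ioi (a := 1 / 2) (r := 1) (by norm_num) one_pos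
    rw [Real.Gamma_one_half_eq] at h
    norm_num at h ⊢
    exact h
  · rw [← integral_comp_rpow_Ioi_of_pos (p := 2) two_pos,
      ← mul_div_cancel₀ (√Real.pi) two_ne_zero,
      ← integral_exp_neg_sub_div_sq (half_pos hr), ← integral_const_mul, ← integral_mul_const]
    refine setIntegral_congr_fun measurableSet_Ioi fun s hs => ?_
    have hs : 0 < s := hs
    simp only [smul_eq_mul]
    rw [← Real.rpow_mul hs.le, mul_assoc 2 (s ^ (_ : ℝ)), ← mul_assoc (s ^ (_ : ℝ)),
      ← Real.rpow_add hs, mul_assoc, ← Real.exp_add]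
    norm_num
    field_simp
    ring

theorem two_mul_sum_sub_le_dotProduct_inv {ι : Type*} [Fintype ι] [DecidableEq ι]
    {A : Matrix ι ι ℝ} (hA : A.IsSymm) (hpos : ∀ v : ι → ℝ, v ≠ 0 → 0 < v ⬝ᵥ A *ᵥ v)
    (v : ι → ℝ) :
    2 * ∑ i, v i - v ⬝ᵥ A *ᵥ v ≤ (fun _ => (1 : ℝ)) ⬝ᵥ A⁻¹ *ᵥ fun _ => (1 : ℝ) := by
  have hdet : IsUnit A.det := by
    refine isUnit_iff_ne_zero.2 fun h => ?_
    obtain ⟨w, hw, hw0⟩ := Matrix.exists_mulVec_eq_zero_iff.2 h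
    simpa [hw0] using hpos w hw
  set one : ι → ℝ := fun _ => 1 with hone
  set u := A⁻¹ *ᵥ one with hu
  have hAu : A *ᵥ u = one := by
    rw [hu, Matrix.mulVec_mulVec, Matrix.mul_nonsing_inv _ hdet, Matrix.one_mulVec]
  have h1 : 0 ≤ (v - u) ⬝ᵥ A *ᵥ (v - u) := by
    by_cases h : v - u = 0
    · simp [h]
    · exact (hpos _ h).le
  have h2 : u ⬝ᵥ A *ᵥ v = one ⬝ᵥ v := by
    rw [Matrix.dotProduct_mulVec, ← Matrix.mulVec_transpose, hA.eq, hAu]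
  have h3 : v ⬝ᵥ one = ∑ i, v i := by simp [dotProduct, hone]
  rw [Matrix.mulVec_sub, hAu, dotProduct_sub, sub_dotProduct, sub_dotProduct, h2,
    dotProduct_comm one v, h3, dotProduct_comm u one] at h1
  linarith

theorem exists_two_mul_sum_sub_eq_dotProduct_inv {ι : Type*} [Fintype ι] [DecidableEq ι]
    {A : Matrix ι ι ℝ} (hpos : ∀ v : ι → ℝ, v ≠ 0 → 0 < v ⬝ᵥ A *ᵥ v) :
    ∃ v : ι → ℝ, 2 * ∑ i, v i - v ⬝ᵥ A *ᵥ v =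
      (fun _ => (1 : ℝ)) ⬝ᵥ A⁻¹ *ᵥ fun _ => (1 : ℝ) := by
  have hdet : IsUnit A.det := by
    refine isUnit_iff_ne_zero.2 fun h => ?_
    obtain ⟨w, hw, hw0⟩ := Matrix.exists_mulVec_eq_zero_iff.2 h
    simpa [hw0] using hpos w hw
  refine ⟨A⁻¹ *ᵥ fun _ => (1 : ℝ), ?_⟩
  rw [Matrix.mulVec_mulVec, Matrix.mul_nonsing_inv _ hdet, Matrix.one_mulVec]
  simp only [dotProduct, mul_one, one_mul]
  ring

theorem dotProduct_exp_mulVec {V : Type*} [NormedAddCommGroup V] {ι : Type*} [Fintype ι]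
    (t : ℝ) (y : ι → V) (v : ι → ℝ) :
    v ⬝ᵥ (Matrix.of fun i j => Real.exp (-(t * dist (y i) (y j)))) *ᵥ v =
      ∑ i, ∑ j, v i * v j * Real.exp (-(t * ‖y i - y j‖)) := by
  simp only [dotProduct, Matrix.mulVec, Matrix.of_apply, Finset.mul_sum, dist_eq_norm]
  refine Finset.sum_congr rfl fun i _ => Finset.sum_congr rfl fun j _ => ?_
  ring

/-- A set covered by finitely many balls splits into disjoint measurable pieces, one per ball. -/
theorem exists_measurable_partition_of_cover {V : Type*} [PseudoMetricSpace V]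
    [MeasurableSpace V] [OpensMeasurableSpace V] {X : Set V} (hX : MeasurableSet X) {δ : ℝ}
    {Y : Finset V} (hcov : X ⊆ ⋃ a ∈ Y, Metric.ball a δ) :
    ∃ B : ↥Y → Set V, (∀ a, MeasurableSet (B a)) ∧ Pairwise (Function.onFun Disjoint B) ∧
      ⋃ a, B a = X ∧ ∀ a, B a ⊆ Metric.ball (a : V) δ := by
  set e := Y.equivFin
  set A : Fin Y.card → Set V := fun i => X ∩ Metric.ball (e.symm i : V) δ with hA
  refine ⟨fun a => disjointed A (e a), fun a => ?_, fun a b hab => ?_, ?_, fun a => ?_⟩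
  · exact disjointedRec (fun _ _ h => h.diff (hX.inter measurableSet_ball))
      (hX.inter measurableSet_ball)
  · exact disjoint_disjointed A (e.injective.ne hab)
  · rw [e.surjective.iUnion_comp (disjointed A), iUnion_disjointed]
    refine subset_antisymm (iUnion_subset fun i => inter_subset_left) fun x hx => ?_
    obtain ⟨a, ha, hxa⟩ := mem_iUnion₂.1 (hcov hx)
    exact mem_iUnion.2 ⟨e ⟨a, ha⟩, hx, by simpa using hxa⟩
  · refine (disjointed_subset A (e a)).trans ?_
    simp [hA]

section ExpKernel

variable {V : Type*} [NormedAddCommGroup V] [InnerProductSpace ℝ V]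

/-- The Fourier transform of `x ↦ exp (-‖x‖)` on a Euclidean space. -/
noncomputable def expNormFourier (ξ : V) : ℝ :=
  (4 * Real.pi) ^ ((Module.finrank ℝ V : ℝ) / 2) * Real.Gamma (((Module.finrank ℝ V : ℝ) + 1) / 2)
    / √Real.pi * (1 + 4 * Real.pi ^ 2 * ‖ξ‖ ^ 2) ^ (-(((Module.finrank ℝ V : ℝ) + 1) / 2))

theorem expNormFourier_pos (ξ : V) : 0 < expNormFourier ξ := by
  have := Real.Gamma_pos_of_pos (show 0 < ((Module.finrank ℝ V : ℝ) + 1) / 2 by positivity)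
  have := Real.pi_pos
  unfold expNormFourier
  positivity

theorem continuous_expNormFourier : Continuous (expNormFourier : V → ℝ) := by
  unfold expNormFourier
  refine continuous_const.mul (Continuous.rpow_const (by fun_prop) fun ξ => Or.inl ?_)
  positivity

/-- The density of the mixture of Gaussians making up `expNormFourier`. -/
noncomputable def expNormMixing (V : Type*) [NormedAddCommGroup V] [InnerProductSpace ℝ V]
    (u : ℝ) : ℝ :=
  (4 * Real.pi) ^ ((Module.finrank ℝ V : ℝ) / 2) / √Real.pi *
    (u ^ (((Module.finrank ℝ V : ℝ) + 1) / 2 - 1) * Real.exp (-u))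

theorem integral_expNormMixing_mul_exp (ξ : V) :
    ∫ u in Ioi (0 : ℝ), expNormMixing V u * Real.exp (-(4 * Real.pi ^ 2 * u * ‖ξ‖ ^ 2)) =
      expNormFourier ξ := by
  have hr : 0 < 1 + 4 * Real.pi ^ 2 * ‖ξ‖ ^ 2 := by positivity
  have h := Real.integral_rpow_mul_exp_neg_mul_Ioi
    (show 0 < ((Module.finrank ℝ V : ℝ) + 1) / 2 by positivity) hr
  have hC : ∀ u : ℝ, expNormMixing V u * Real.exp (-(4 * Real.pi ^ 2 * u * ‖ξ‖ ^ 2)) =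
      (4 * Real.pi) ^ ((Module.finrank ℝ V : ℝ) / 2) / √Real.pi *
      (u ^ (((Module.finrank ℝ V : ℝ) + 1) / 2 - 1) *
        Real.exp (-((1 + 4 * Real.pi ^ 2 * ‖ξ‖ ^ 2) * u))) := by
    intro u
    rw [expNormMixing, mul_assoc, mul_assoc, ← Real.exp_add]
    ring_nf
  simp_rw [hC]
  rw [integral_const_mul, h, one_div, Real.inv_rpow hr.le, ← Real.rpow_neg hr.le, expNormFourier]
  ring

theorem integrableOn_expNormMixing_mul_exp (ξ : V) :
    IntegrableOn (fun u => expNormMixing V u * Real.exp (-(4 * Real.pi ^ 2 * u * ‖ξ‖ ^ 2)))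
      (Ioi 0) := by
  by_contra h
  have h1 := integral_undef h
  rw [integral_expNormMixing_mul_exp] at h1
  exact (expNormFourier_pos ξ).ne' h1

theorem measurable_expNormMixing : Measurable (expNormMixing V) := by
  unfold expNormMixing
  fun_prop

theorem expNormMixing_nonneg {u : ℝ} (hu : 0 < u) : 0 ≤ expNormMixing V u := by
  have := Real.pi_pos
  unfold expNormMixing
  positivity

/-- The exponential sum with frequencies `y` and coefficients `v`. -/
noncomputable def expSum {ι : Type*} [Fintype ι] (y : ι → V) (v : ι → ℝ) (ξ : V) : ℂ :=
  ∑ i, (v i : ℂ) * Complex.exp (2 * Real.pi * Complex.I * inner ℝ (y i) ξ)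

theorem norm_cexp_two_pi_I (a : ℝ) : ‖Complex.exp (2 * Real.pi * Complex.I * a)‖ = 1 := by
  rw [show (2 * Real.pi * Complex.I * a : ℂ) = ((2 * Real.pi * a : ℝ) : ℂ) * Complex.I by
    push_cast; ring, Complex.norm_exp_ofReal_mul_I]

theorem continuous_expSum {ι : Type*} [Fintype ι] (y : ι → V) (v : ι → ℝ) :
    Continuous (expSum y v) := by
  unfold expSum
  fun_prop

theorem norm_expSum_le {ι : Type*} [Fintype ι] (y : ι → V) (v : ι → ℝ) (ξ : V) :
    ‖expSum y v ξ‖ ≤ ∑ i, |v i| := by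
  refine (norm_sum_le _ _).trans_eq ?_
  simp_rw [norm_mul, norm_cexp_two_pi_I, mul_one, Complex.norm_real, Real.norm_eq_abs]

theorem norm_expSum_sq {ι : Type*} [Fintype ι] (y : ι → V) (v : ι → ℝ) (ξ : V) :
    ((‖expSum y v ξ‖ ^ 2 : ℝ) : ℂ) = ∑ i, ∑ j, (v i * v j : ℂ) *
      Complex.exp (2 * Real.pi * Complex.I * inner ℝ (y i - y j) ξ) := by
  rw [Complex.ofReal_pow, ← Complex.mul_conj', expSum, map_sum, Finset.sum_mul_sum]
  refine Finset.sum_congr rfl fun i _ => Finset.sum_congr rfl fun j _ => ?_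
  rw [map_mul, ← Complex.exp_conj, Complex.conj_ofReal, mul_mul_mul_comm, ← Complex.exp_add]
  simp only [map_mul, Complex.conj_ofReal, Complex.conj_I, inner_sub_left, map_ofNat]
  push_cast
  ring_nf

theorem exists_inv_expNormFourier_le :
    ∃ A : ℝ, 0 ≤ A ∧ ∀ ξ : V, (expNormFourier ξ)⁻¹ ≤
      A * (1 + ‖ξ‖ ^ (2 * (Module.finrank ℝ V + 1))) := by
  set d := Module.finrank ℝ V with hd
  have hpi := Real.pi_pos
  have hG := Real.Gamma_pos_of_pos (show 0 < ((d : ℝ) + 1) / 2 by positivity)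
  set C := (4 * Real.pi) ^ ((d : ℝ) / 2) * Real.Gamma (((d : ℝ) + 1) / 2) / √Real.pi with hC
  have hC0 : 0 < C := by positivity
  refine ⟨C⁻¹ * (2 ^ d * (4 * Real.pi ^ 2) ^ (d + 1)), by positivity, fun ξ => ?_⟩
  rw [expNormFourier, ← hd, ← hC, mul_inv, mul_assoc C⁻¹, Real.rpow_neg (by positivity), inv_inv]
  gcongr
  have h1 : (1 : ℝ) ≤ 4 * Real.pi ^ 2 := by nlinarith [Real.pi_gt_three]
  calc (1 + 4 * Real.pi ^ 2 * ‖ξ‖ ^ 2) ^ (((d : ℝ) + 1) / 2)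
      ≤ (1 + 4 * Real.pi ^ 2 * ‖ξ‖ ^ 2) ^ ((d + 1 : ℕ) : ℝ) := by
        refine Real.rpow_le_rpow_of_exponent_le (le_add_of_nonneg_right (by positivity)) ?_
        push_cast
        have : (0 : ℝ) ≤ d := Nat.cast_nonneg d
        linarith
    _ = (1 + 4 * Real.pi ^ 2 * ‖ξ‖ ^ 2) ^ (d + 1) := Real.rpow_natCast _ _
    _ ≤ 2 ^ d * (1 ^ (d + 1) + (4 * Real.pi ^ 2 * ‖ξ‖ ^ 2) ^ (d + 1)) := by
        simpa using add_pow_le zero_le_one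
          (show 0 ≤ 4 * Real.pi ^ 2 * ‖ξ‖ ^ 2 by positivity) (d + 1)
    _ ≤ 2 ^ d * ((4 * Real.pi ^ 2) ^ (d + 1) +
          (4 * Real.pi ^ 2) ^ (d + 1) * ‖ξ‖ ^ (2 * (d + 1))) := by
        rw [one_pow, mul_pow (4 * Real.pi ^ 2), ← pow_mul ‖ξ‖]
        gcongr
        exact one_le_pow₀ h1
    _ = 2 ^ d * (4 * Real.pi ^ 2) ^ (d + 1) * (1 + ‖ξ‖ ^ (2 * (d + 1))) := by ring

variable [FiniteDimensional ℝ V]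

/-- A Schwartz bump function that is `1` on a compact set and supported in a neighbourhood. -/
theorem exists_schwartz_eq_one_on {K U : Set V} (hK : IsCompact K) (hU : IsOpen U)
    (hKU : K ⊆ U) : ∃ f : 𝓢(V, ℂ), (∀ x ∈ K, f x = 1) ∧ (∀ x, ‖f x‖ ≤ 1) ∧
      ∀ x, x ∉ U → f x = 0 := by
  obtain ⟨L, hL, hKL, hLU⟩ := exists_compact_between hK hU hKU
  obtain ⟨g, hg1, hg0, hg01⟩ := exists_contMDiffMap_one_nhds_of_subset_interior
    (n := (⊤ : ℕ∞)) (modelWithCornersSelf ℝ V) hK.isClosed hKL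
  have hcs : HasCompactSupport (fun x => (g x : ℂ)) := by
    refine HasCompactSupport.intro hL fun x hx => ?_
    rw [hg0 x hx, Complex.ofReal_zero]
  have hsm : ContDiff ℝ (⊤ : ℕ∞) (fun x => (g x : ℂ)) :=
    Complex.ofRealCLM.contDiff.comp g.contMDiff.contDiff
  refine ⟨hcs.toSchwartzMap hsm, fun x hx => ?_, fun x => ?_, fun x hx => ?_⟩
  · have := hg1.self_of_nhdsSet x hx
    simp [this]
  · have := hg01 x
    simp [abs_of_nonneg this.1, this.2]
  · simp [hg0 x fun h => hx (hLU h)]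

variable [MeasurableSpace V] [BorelSpace V]

theorem integrable_expNormFourier : Integrable (expNormFourier : V → ℝ) := by
  unfold expNormFourier
  refine Integrable.const_mul ?_ _
  have h := integrable_rpow_neg_one_add_norm_sq (E := V) (μ := volume)
    (r := (Module.finrank ℝ V : ℝ) + 1) (by linarith)
  refine h.mono' ?_ (Eventually.of_forall fun ξ => ?_)
  · refine (Continuous.rpow_const (by fun_prop) fun ξ => Or.inl ?_).aestronglyMeasurable
    positivity
  · rw [Real.norm_eq_abs, abs_of_nonneg (by positivity), neg_div]
    refine Real.rpow_le_rpow_of_nonpos (by positivity) ?_ (neg_nonpos.2 (by positivity))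
    have : (1 : ℝ) ≤ 4 * Real.pi ^ 2 := by nlinarith [Real.pi_gt_three]
    nlinarith [sq_nonneg ‖ξ‖]

/-- Fourier inversion for `x ↦ exp (-‖x‖)`. -/
theorem integral_expNormFourier_mul_cexp (x : V) :
    ∫ ξ : V, (expNormFourier ξ : ℂ) * Complex.exp (2 * Real.pi * Complex.I * inner ℝ x ξ) =
      Complex.exp (-‖x‖) := by
  set F : V → ℝ → ℂ := fun ξ u =>
    ((expNormMixing V u * Real.exp (-(4 * Real.pi ^ 2 * u * ‖ξ‖ ^ 2)) : ℝ) : ℂ) *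
      Complex.exp (2 * Real.pi * Complex.I * inner ℝ x ξ) with hF
  have hnorm : ∀ ξ : V, ∀ u ∈ Ioi (0 : ℝ), ‖F ξ u‖ =
      expNormMixing V u * Real.exp (-(4 * Real.pi ^ 2 * u * ‖ξ‖ ^ 2)) := by
    intro ξ u hu
    rw [hF]
    simp only
    rw [norm_mul, Complex.norm_real, Real.norm_eq_abs,
      abs_of_nonneg (mul_nonneg (expNormMixing_nonneg hu) (Real.exp_pos _).le),
      show (2 * Real.pi * Complex.I * inner ℝ x ξ : ℂ) = ((2 * Real.pi * inner ℝ x ξ : ℝ) : ℂ) *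
        Complex.I by push_cast; ring, Complex.norm_exp_ofReal_mul_I, mul_one]
  have hmeas : AEStronglyMeasurable (Function.uncurry F)
      ((volume : Measure V).prod (volume.restrict (Ioi (0 : ℝ)))) := by
    have := measurable_expNormMixing (V := V)
    refine Measurable.aestronglyMeasurable ?_
    unfold Function.uncurry
    fun_prop
  have hint : Integrable (Function.uncurry F)
      ((volume : Measure V).prod (volume.restrict (Ioi (0 : ℝ)))) := by
    rw [integrable_prod_iff hmeas]
    constructor
    · refine Eventually.of_forall fun ξ => ?_
      have h := (integrableOn_expNormMixing_mul_exp ξ).ofReal (𝕜 := ℂ)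
      simp only [Function.uncurry, hF]
      exact h.mul_const _
    · refine (integrable_expNormFourier (V := V)).congr (Eventually.of_forall fun ξ => ?_)
      simp only [Function.uncurry]
      rw [setIntegral_congr_fun measurableSet_Ioi (hnorm ξ), integral_expNormMixing_mul_exp]
  have hswap := integral_integral_swap hint
  have hl : ∀ ξ, ∫ u in Ioi (0 : ℝ), F ξ u =
      (expNormFourier ξ : ℂ) * Complex.exp (2 * Real.pi * Complex.I * inner ℝ x ξ) := by
    intro ξ
    rw [hF, integral_mul_const, integral_complex_ofReal, integral_expNormMixing_mul_exp]
  simp_rw [hl] at hswap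
  rw [hswap]
  have hr : ∀ u ∈ Ioi (0 : ℝ), ∫ ξ, F ξ u =
      (((√Real.pi)⁻¹ * (u ^ (-(1 / 2) : ℝ) * Real.exp (-u - ‖x‖ ^ 2 / (4 * u))) : ℝ) : ℂ) := by
    intro u hu
    have hu : 0 < u := hu
    have hpi := Real.pi_pos
    have hb : 0 < (((4 * Real.pi ^ 2 * u : ℝ) : ℂ)).re := by
      rw [Complex.ofReal_re]; positivity
    have h := GaussianFourier.integral_cexp_neg_mul_sq_norm_add hb (2 * Real.pi * Complex.I) x
    have hFe : ∀ ξ, F ξ u = (expNormMixing V u : ℂ) *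
        Complex.exp (-((4 * Real.pi ^ 2 * u : ℝ) : ℂ) * ‖ξ‖ ^ 2 +
          2 * Real.pi * Complex.I * inner ℝ x ξ) := by
      intro ξ
      rw [hF, Complex.exp_add]
      push_cast
      ring_nf
    simp_rw [hFe]
    rw [integral_const_mul, h]
    have e1 : ((Real.pi : ℂ) / ((4 * Real.pi ^ 2 * u : ℝ) : ℂ)) ^ ((Module.finrank ℝ V : ℂ) / 2) =
        (((4 * Real.pi * u) ^ (-((Module.finrank ℝ V : ℝ) / 2)) : ℝ) : ℂ) := by
      rw [Real.rpow_neg (by positivity), ← Real.inv_rpow (by positivity),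
        Complex.ofReal_cpow (by positivity)]
      push_cast
      congr 1
      have : (Real.pi : ℂ) ≠ 0 := by exact_mod_cast hpi.ne'
      field_simp
    have e2 : (2 * Real.pi * Complex.I) ^ 2 * (‖x‖ : ℂ) ^ 2 /
        (4 * ((4 * Real.pi ^ 2 * u : ℝ) : ℂ)) = ((-(‖x‖ ^ 2 / (4 * u)) : ℝ) : ℂ) := by
      have : (Real.pi : ℂ) ≠ 0 := by exact_mod_cast hpi.ne'
      have : (u : ℂ) ≠ 0 := by exact_mod_cast hu.ne'
      rw [mul_pow, Complex.I_sq]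
      push_cast
      field_simp
      ring
    rw [e1, e2, ← Complex.ofReal_exp, ← Complex.ofReal_mul, ← Complex.ofReal_mul, expNormMixing]
    congr 1
    rw [Real.mul_rpow (by positivity) hu.le, sub_eq_add_neg (-u), Real.exp_add,
      Real.rpow_neg (by positivity : 0 ≤ 4 * Real.pi), show (-(1 / 2) : ℝ) =
      ((Module.finrank ℝ V : ℝ) + 1) / 2 - 1 + -((Module.finrank ℝ V : ℝ) / 2) by ring,
      Real.rpow_add hu]
    have : 0 < (4 * Real.pi) ^ ((Module.finrank ℝ V : ℝ) / 2) := by positivity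
    have : 0 < √Real.pi := by positivity
    field_simp
  rw [setIntegral_congr_fun measurableSet_Ioi hr, integral_complex_ofReal, integral_const_mul,
    integral_rpow_mul_exp_neg_sub_sq_div (norm_nonneg x), ← Complex.ofReal_neg,
    ← Complex.ofReal_exp]
  congr 1
  have : 0 < √Real.pi := Real.sqrt_pos.2 Real.pi_pos
  field_simp

theorem integral_exp_neg_norm_eq_factorial_mul :
    ∫ x : V, Real.exp (-‖x‖) =
      ((Module.finrank ℝ V).factorial : ℝ) * (volume (Metric.ball (0 : V) 1)).toReal := by
  have h := measure_unitBall_eq_integral_div_gamma (volume : Measure V) one_pos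
  simp only [Real.rpow_one, div_one, Real.Gamma_nat_eq_factorial] at h
  have h0 : 0 ≤ ∫ x : V, Real.exp (-‖x‖) := integral_nonneg fun x => (Real.exp_pos _).le
  rw [h, ENNReal.toReal_ofReal (by positivity)]
  field_simp

theorem integrable_exp_neg_norm : Integrable (fun x : V => Real.exp (-‖x‖)) := by
  by_contra h
  have h1 := integral_undef h
  rw [integral_exp_neg_norm_eq_factorial_mul] at h1
  have h2 : 0 < (volume (Metric.ball (0 : V) 1)).toReal :=
    ENNReal.toReal_pos (Metric.measure_ball_pos _ _ one_pos).ne' measure_ball_lt_top.ne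
  have : 0 < ((Module.finrank ℝ V).factorial : ℝ) := by positivity
  exact (mul_pos this h2).ne' h1

theorem integral_exp_neg_norm_eq :
    ∫ x : V, Real.exp (-‖x‖) = expNormFourier (0 : V) := by
  set w : V → ℂ := fun ξ => (expNormFourier ξ : ℂ) with hw
  have hwc : Continuous w := Complex.continuous_ofReal.comp continuous_expNormFourier
  have hwi : Integrable w := integrable_expNormFourier.ofReal
  have hinv : 𝓕⁻ w = fun x => ((Real.exp (-‖x‖) : ℝ) : ℂ) := by
    ext x
    rw [Real.fourierInv_eq', Complex.ofReal_exp, Complex.ofReal_neg,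
      ← integral_expNormFourier_mul_cexp]
    congr 1 with ξ
    rw [real_inner_comm, smul_eq_mul, mul_comm, hw]
    congr 2
    push_cast
    ring
  have hfor : 𝓕 w = fun x => ((Real.exp (-‖x‖) : ℝ) : ℂ) := by
    ext x
    have := congrFun hinv (-x)
    rw [Real.fourierInv_eq_fourier_neg, neg_neg, norm_neg] at this
    exact this
  have hint : Integrable (𝓕 w) := by
    rw [hfor]
    exact integrable_exp_neg_norm.ofReal
  have h0 := congrFun (hwc.fourier_fourierInv_eq hwi hint) 0
  rw [hinv, Real.fourier_eq'] at h0
  simp only [inner_zero_right, mul_zero, Complex.ofReal_zero, zero_mul, Complex.exp_zero,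
    one_smul] at h0
  rw [integral_complex_ofReal] at h0
  exact Complex.ofReal_injective h0

theorem integral_expNormFourier_smul_mul_cexp {t : ℝ} (ht : 0 < t) (x : V) :
    ∫ ξ : V, (expNormFourier (t⁻¹ • ξ) : ℂ) *
        Complex.exp (2 * Real.pi * Complex.I * inner ℝ x ξ) =
      (t ^ Module.finrank ℝ V * Real.exp (-(t * ‖x‖)) : ℝ) := by
  have h := Measure.integral_comp_smul volume (fun ξ : V => (expNormFourier ξ : ℂ) *
        Complex.exp (2 * Real.pi * Complex.I * inner ℝ (t • x) ξ)) t⁻¹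
  rw [integral_expNormFourier_mul_cexp, norm_smul, Real.norm_eq_abs, abs_of_pos ht, inv_pow,
    inv_inv, abs_of_pos (pow_pos ht _)] at h
  rw [Complex.ofReal_mul, Complex.ofReal_exp, Complex.ofReal_neg, ← Complex.real_smul, ← h]
  congr 1 with ξ
  rw [inner_smul_left, inner_smul_right, ← mul_assoc (starRingEnd ℝ t)]
  simp [ht.ne']

theorem integrable_expNormFourier_smul {t : ℝ} (ht : 0 < t) :
    Integrable (fun ξ : V => expNormFourier (t⁻¹ • ξ)) :=
  integrable_expNormFourier.comp_smul (inv_ne_zero ht.ne')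

theorem integrable_expNormFourier_mul_expSum_sq {ι : Type*} [Fintype ι] {t : ℝ} (ht : 0 < t)
    (y : ι → V) (v : ι → ℝ) :
    Integrable (fun ξ : V => expNormFourier (t⁻¹ • ξ) * ‖expSum y v ξ‖ ^ 2) := by
  refine (integrable_expNormFourier_smul ht).mul_bdd (c := (∑ i, |v i|) ^ 2)
    ((continuous_expSum y v).norm.pow 2).aestronglyMeasurable (Eventually.of_forall fun ξ => ?_)
  rw [norm_pow, norm_norm]
  gcongr
  exact norm_expSum_le y v ξ

theorem integral_expNormFourier_mul_expSum_sq {ι : Type*} [Fintype ι] {t : ℝ} (ht : 0 < t)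
    (y : ι → V) (v : ι → ℝ) :
    ∫ ξ : V, expNormFourier (t⁻¹ • ξ) * ‖expSum y v ξ‖ ^ 2 =
      t ^ Module.finrank ℝ V * ∑ i, ∑ j, v i * v j * Real.exp (-(t * ‖y i - y j‖)) := by
  apply Complex.ofReal_injective
  rw [← integral_complex_ofReal]
  have hi : ∀ x : V, Integrable (fun ξ : V => (expNormFourier (t⁻¹ • ξ) : ℂ) *
      Complex.exp (2 * Real.pi * Complex.I * inner ℝ x ξ)) := fun x =>
    ((integrable_expNormFourier_smul ht).ofReal (𝕜 := ℂ)).mul_bdd (c := 1)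
      (by fun_prop) (Eventually.of_forall fun ξ => (norm_cexp_two_pi_I _).le)
  have h : ∀ ξ : V, ((expNormFourier (t⁻¹ • ξ) * ‖expSum y v ξ‖ ^ 2 : ℝ) : ℂ) =
      ∑ i, ∑ j, (v i * v j : ℂ) * ((expNormFourier (t⁻¹ • ξ) : ℂ) *
        Complex.exp (2 * Real.pi * Complex.I * inner ℝ (y i - y j) ξ)) := by
    intro ξ
    rw [Complex.ofReal_mul, norm_expSum_sq, Finset.mul_sum]
    refine Finset.sum_congr rfl fun i _ => ?_
    rw [Finset.mul_sum]
    refine Finset.sum_congr rfl fun j _ => ?_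
    ring
  simp_rw [h]
  rw [integral_finsetSum _ fun i _ => integrable_finsetSum _ fun j _ => (hi _).const_mul _]
  simp_rw [integral_finsetSum _ fun j _ => (hi (_ - y j)).const_mul _, integral_const_mul,
    integral_expNormFourier_smul_mul_cexp ht]
  push_cast
  rw [Finset.mul_sum]
  refine Finset.sum_congr rfl fun i _ => ?_
  rw [Finset.mul_sum]
  refine Finset.sum_congr rfl fun j _ => ?_
  ring


theorem integrable_norm_sq_mul_one_add_pow (f : 𝓢(V, ℂ)) (k : ℕ) :
    Integrable (fun ξ : V => ‖f ξ‖ ^ 2 * (1 + ‖ξ‖ ^ k)) := by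
  obtain ⟨B, hB⟩ : ∃ B : ℝ, ∀ ξ, ‖f ξ‖ ≤ B := by
    obtain ⟨B, -, hB⟩ := f.decay 0 0
    exact ⟨B, fun ξ => by simpa using hB ξ⟩
  have h : Integrable (fun ξ : V => ‖f ξ‖ + ‖ξ‖ ^ k * ‖f ξ‖) :=
    f.integrable.norm.add (f.integrable_pow_mul volume k)
  have hf := f.continuous
  refine (h.const_mul B).mono' (by fun_prop) (Eventually.of_forall fun ξ => ?_)
  rw [Real.norm_eq_abs, abs_of_nonneg (by positivity)]
  calc ‖f ξ‖ ^ 2 * (1 + ‖ξ‖ ^ k) = ‖f ξ‖ * (‖f ξ‖ + ‖ξ‖ ^ k * ‖f ξ‖) := by ring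
    _ ≤ B * (‖f ξ‖ + ‖ξ‖ ^ k * ‖f ξ‖) := by
      gcongr
      exact hB ξ

/-- The squared norm, up to a power of `t`, of a Schwartz function in the reproducing kernel
Hilbert space of `(x, y) ↦ exp (-t * ‖x - y‖)`. -/
noncomputable def expEnergy (f : 𝓢(V, ℂ)) (t : ℝ) : ℝ :=
  ∫ ξ : V, ‖𝓕 f ξ‖ ^ 2 * (expNormFourier (t⁻¹ • ξ))⁻¹

theorem continuous_norm_fourier_sq_mul_inv (f : 𝓢(V, ℂ)) (t : ℝ) :
    Continuous (fun ξ : V => ‖𝓕 f ξ‖ ^ 2 * (expNormFourier (t⁻¹ • ξ))⁻¹) :=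
  ((𝓕 f).continuous.norm.pow 2).mul <|
    (continuous_expNormFourier.comp (continuous_const_smul _)).inv₀
      fun _ => (expNormFourier_pos _).ne'

theorem integrable_norm_fourier_sq_mul_inv (f : 𝓢(V, ℂ)) (t : ℝ) :
    Integrable (fun ξ : V => ‖𝓕 f ξ‖ ^ 2 * (expNormFourier (t⁻¹ • ξ))⁻¹) := by
  obtain ⟨A, hA, h⟩ := exists_inv_expNormFourier_le (V := V)
  set k := 2 * (Module.finrank ℝ V + 1)
  refine ((integrable_norm_sq_mul_one_add_pow (𝓕 f) k).const_mul (A * (1 + |t⁻¹| ^ k))).mono'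
    (continuous_norm_fourier_sq_mul_inv f t).aestronglyMeasurable (Eventually.of_forall fun ξ => ?_)
  have hw := expNormFourier_pos (t⁻¹ • ξ)
  rw [Real.norm_eq_abs, abs_of_nonneg (by positivity)]
  have h2 := h (t⁻¹ • ξ)
  rw [norm_smul, Real.norm_eq_abs, mul_pow] at h2
  have h3 : 1 + |t⁻¹| ^ k * ‖ξ‖ ^ k ≤ (1 + |t⁻¹| ^ k) * (1 + ‖ξ‖ ^ k) := by
    have : 0 ≤ |t⁻¹| ^ k := by positivity
    have : 0 ≤ ‖ξ‖ ^ k := by positivity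
    nlinarith
  calc _ ≤ ‖𝓕 f ξ‖ ^ 2 * (A * ((1 + |t⁻¹| ^ k) * (1 + ‖ξ‖ ^ k))) := by
        gcongr
        exact h2.trans (by gcongr)
    _ = _ := by ring

theorem expEnergy_nonneg (f : 𝓢(V, ℂ)) (t : ℝ) : 0 ≤ expEnergy f t :=
  integral_nonneg fun ξ => mul_nonneg (by positivity) (inv_nonneg.2 (expNormFourier_pos _).le)

theorem tendsto_expEnergy (f : 𝓢(V, ℂ)) :
    Tendsto (expEnergy f) atTop
      (𝓝 ((∫ x, ‖f x‖ ^ 2) / ∫ x : V, Real.exp (-‖x‖))) := by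
  obtain ⟨A, hA, h⟩ := exists_inv_expNormFourier_le (V := V)
  set k := 2 * (Module.finrank ℝ V + 1)
  rw [← SchwartzMap.integral_norm_sq_fourier, integral_exp_neg_norm_eq, div_eq_mul_inv,
    ← integral_mul_const]
  refine tendsto_integral_filter_of_dominated_convergence
    (fun ξ => A * (‖𝓕 f ξ‖ ^ 2 * (1 + ‖ξ‖ ^ k)))
    (Eventually.of_forall fun t => (continuous_norm_fourier_sq_mul_inv f t).aestronglyMeasurable)
    ?_ ((integrable_norm_sq_mul_one_add_pow (𝓕 f) k).const_mul A)
    (Eventually.of_forall fun ξ => ?_)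
  · filter_upwards [eventually_ge_atTop (1 : ℝ)] with t ht
    refine Eventually.of_forall fun ξ => ?_
    have hw := expNormFourier_pos (t⁻¹ • ξ)
    rw [Real.norm_eq_abs, abs_of_nonneg (by positivity)]
    have hn : ‖t⁻¹ • ξ‖ ≤ ‖ξ‖ := by
      rw [norm_smul, Real.norm_eq_abs, abs_of_pos (by positivity)]
      exact mul_le_of_le_one_left (norm_nonneg _) (inv_le_one_of_one_le₀ ht)
    calc _ ≤ ‖𝓕 f ξ‖ ^ 2 * (A * (1 + ‖ξ‖ ^ k)) := by
          gcongr
          exact (h _).trans (by gcongr)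
      _ = _ := by ring
  · have h1 : Tendsto (fun t : ℝ => t⁻¹ • ξ) atTop (𝓝 0) := by
      simpa using (tendsto_inv_atTop_zero (𝕜 := ℝ)).smul_const ξ
    exact (((continuous_expNormFourier.tendsto 0).comp h1).inv₀
      (expNormFourier_pos _).ne').const_mul _

/-- The duality estimate behind the upper bound for magnitude. -/
theorem two_mul_sum_le_expEnergy_add {ι : Type*} [Fintype ι] {t : ℝ} (ht : 0 < t)
    (f : 𝓢(V, ℂ)) (y : ι → V) (v : ι → ℝ) :
    2 * ∑ i, v i * (f (y i)).re ≤ t ^ Module.finrank ℝ V * expEnergy f t +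
      ∑ i, ∑ j, v i * v j * Real.exp (-(t * ‖y i - y j‖)) := by
  set c := t ^ Module.finrank ℝ V with hc
  have hc0 : 0 < c := pow_pos ht _
  have hint : Integrable (fun ξ : V => 𝓕 f ξ * expSum y v ξ) :=
    (𝓕 f).integrable.mul_bdd (c := ∑ i, |v i|) (continuous_expSum y v).aestronglyMeasurable
      (Eventually.of_forall (norm_expSum_le y v))
  have hinv : ∀ x, f x =
      ∫ ξ : V, 𝓕 f ξ * Complex.exp (2 * Real.pi * Complex.I * inner ℝ x ξ) := by
    intro x
    have hf : 𝓕⁻ (𝓕 f) = f := FourierTransform.fourierInv_fourier_eq f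
    conv_lhs => rw [← hf]
    rw [SchwartzMap.fourierInv_coe, Real.fourierInv_eq']
    congr 1 with ξ
    rw [real_inner_comm, smul_eq_mul, mul_comm]
    congr 2
    push_cast
    ring
  have hsum : ∑ i, (v i : ℂ) * f (y i) = ∫ ξ : V, 𝓕 f ξ * expSum y v ξ := by
    have hi : ∀ x : V, Integrable (fun ξ : V => 𝓕 f ξ *
        Complex.exp (2 * Real.pi * Complex.I * inner ℝ x ξ)) := fun x =>
      (𝓕 f).integrable.mul_bdd (c := 1)
        (by fun_prop) (Eventually.of_forall fun ξ => (norm_cexp_two_pi_I _).le)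
    simp_rw [hinv, ← integral_const_mul]
    rw [← integral_finsetSum _ fun i _ => (hi _).const_mul _]
    congr 1 with ξ
    rw [expSum, Finset.mul_sum]
    refine Finset.sum_congr rfl fun i _ => ?_
    ring
  have hre : ∑ i, v i * (f (y i)).re = (∑ i, (v i : ℂ) * f (y i)).re := by
    simp [Complex.re_sum]
  have hq := integral_expNormFourier_mul_expSum_sq ht y v
  rw [← hc] at hq
  have hq' : ∑ i, ∑ j, v i * v j * Real.exp (-(t * ‖y i - y j‖)) =
      c⁻¹ * ∫ ξ : V, expNormFourier (t⁻¹ • ξ) * ‖expSum y v ξ‖ ^ 2 := by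
    rw [hq]
    field_simp
  have i1 := (integrable_norm_fourier_sq_mul_inv f t).const_mul c
  have i2 := (integrable_expNormFourier_mul_expSum_sq ht y v).const_mul c⁻¹
  rw [hre, hsum, hq', expEnergy, ← integral_const_mul, ← integral_const_mul,
    ← integral_add i1 i2]
  calc 2 * (∫ ξ : V, 𝓕 f ξ * expSum y v ξ).re ≤ 2 * ∫ ξ : V, ‖𝓕 f ξ * expSum y v ξ‖ := by
        gcongr
        exact (Complex.re_le_norm _).trans (norm_integral_le_integral_norm _)
    _ = ∫ ξ : V, 2 * ‖𝓕 f ξ * expSum y v ξ‖ := (integral_const_mul _ _).symm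
    _ ≤ _ := by
        refine integral_mono (hint.norm.const_mul 2) (i1.add i2) fun ξ => ?_
        have hw := expNormFourier_pos (t⁻¹ • ξ)
        simp only [norm_mul]
        set w := expNormFourier (t⁻¹ • ξ)
        set a := ‖𝓕 f ξ‖
        set b := ‖expSum y v ξ‖
        have e : c * (a ^ 2 * w⁻¹) + c⁻¹ * (w * b ^ 2) - 2 * (a * b) =
            (c * a - w * b) ^ 2 / (c * w) := by
          field_simp
          ring
        have : 0 ≤ (c * a - w * b) ^ 2 / (c * w) := by positivity
        linarith

/-- Strict positive definiteness of the exponential kernel. -/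
theorem sum_mul_exp_neg_norm_pos {ι : Type*} [Fintype ι] {t : ℝ} (ht : 0 < t)
    {y : ι → V} (hy : Function.Injective y) {v : ι → ℝ} (hv : v ≠ 0) :
    0 < ∑ i, ∑ j, v i * v j * Real.exp (-(t * ‖y i - y j‖)) := by
  have h0 : ∀ v : ι → ℝ, 0 ≤ ∑ i, ∑ j, v i * v j * Real.exp (-(t * ‖y i - y j‖)) := by
    intro v
    simpa [expEnergy] using two_mul_sum_le_expEnergy_add ht (0 : 𝓢(V, ℂ)) y v
  refine (h0 v).lt_of_ne' fun hzero => ?_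
  obtain ⟨k, hk⟩ := Function.ne_iff.1 hv
  obtain ⟨f, hf1, -, hf0⟩ := exists_schwartz_eq_one_on (isCompact_singleton (x := y k))
    (U := (y '' {k}ᶜ)ᶜ) (Set.toFinite _).isClosed.isOpen_compl (by
      rintro _ rfl ⟨i, hi, hik⟩
      exact hi (hy hik))
  set M := t ^ Module.finrank ℝ V * expEnergy f t
  have key := two_mul_sum_le_expEnergy_add ht f y (fun i => (M + 1) / v k * v i)
  have e1 : ∑ i, (M + 1) / v k * v i * (f (y i)).re = M + 1 := by
    rw [Finset.sum_eq_single k]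
    · rw [hf1 _ rfl, Complex.one_re, mul_one]
      field_simp [show v k ≠ 0 from hk]
    · intro i _ hi
      rw [hf0 _ (fun h => h ⟨i, hi, rfl⟩), Complex.zero_re, mul_zero]
    · simp
  have e2 : ∑ i, ∑ j, ((M + 1) / v k * v i) * ((M + 1) / v k * v j) *
      Real.exp (-(t * ‖y i - y j‖)) = 0 := by
    rw [← mul_zero (((M + 1) / v k) ^ 2), ← hzero, Finset.mul_sum]
    refine Finset.sum_congr rfl fun i _ => ?_
    rw [Finset.mul_sum]
    refine Finset.sum_congr rfl fun j _ => ?_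
    ring
  rw [e1, e2] at key
  have hM : 0 ≤ M := mul_nonneg (pow_nonneg ht.le _) (expEnergy_nonneg f t)
  linarith


theorem le_finsetMagnitude {t : ℝ} (ht : 0 < t) (Y : Finset V) (v : ↥Y → ℝ) :
    2 * ∑ i, v i - ∑ i, ∑ j, v i * v j * Real.exp (-(t * ‖(i : V) - j‖)) ≤
      finsetMagnitude t Y := by
  classical
  have h := @two_mul_sum_sub_le_dotProduct_inv ↥Y _
    (letI : DecidableEq V := Classical.decEq V; inferInstance)
    (Matrix.of fun i j : ↥Y => Real.exp (-(t * dist (i : V) (j : V))))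
    (by ext i j; simp [dist_comm]) (fun v hv => by
      rw [dotProduct_exp_mulVec]
      exact sum_mul_exp_neg_norm_pos ht Subtype.val_injective hv) v
  rw [dotProduct_exp_mulVec] at h
  exact h

theorem exists_eq_finsetMagnitude {t : ℝ} (ht : 0 < t) (Y : Finset V) :
    ∃ v : ↥Y → ℝ, 2 * ∑ i, v i - ∑ i, ∑ j, v i * v j * Real.exp (-(t * ‖(i : V) - j‖)) =
      finsetMagnitude t Y := by
  obtain ⟨v, hv⟩ := @exists_two_mul_sum_sub_eq_dotProduct_inv ↥Y _
    (letI : DecidableEq V := Classical.decEq V; inferInstance)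
    (Matrix.of fun i j : ↥Y => Real.exp (-(t * dist (i : V) (j : V))))
    (fun v hv => by
      rw [dotProduct_exp_mulVec]
      exact sum_mul_exp_neg_norm_pos ht Subtype.val_injective hv)
  rw [dotProduct_exp_mulVec] at hv
  exact ⟨v, hv⟩

theorem finsetMagnitude_le_s4 {t : ℝ} (ht : 0 < t) {Y : Finset V} {f : 𝓢(V, ℂ)}
    (hf : ∀ x ∈ Y, f x = 1) :
    finsetMagnitude t Y ≤ t ^ Module.finrank ℝ V * expEnergy f t := by
  obtain ⟨v, hv⟩ := exists_eq_finsetMagnitude ht Y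
  have h := two_mul_sum_le_expEnergy_add ht f (fun i : ↥Y => (i : V)) v
  simp only [hf _ (Subtype.coe_prop _), Complex.one_re, mul_one] at h
  linarith

theorem setMagnitude_le {t : ℝ} (ht : 0 < t) {X : Set V} {f : 𝓢(V, ℂ)}
    (hf : ∀ x ∈ X, f x = 1) :
    setMagnitude t X ≤ t ^ Module.finrank ℝ V * expEnergy f t := by
  refine csSup_le ⟨_, ∅, by simp, rfl⟩ ?_
  rintro _ ⟨Y, hY, rfl⟩
  exact finsetMagnitude_le_s4 ht fun x hx => hf x (hY hx)

theorem finsetMagnitude_le_setMagnitude {t : ℝ} (ht : 0 < t) {X : Set V} (hX : IsCompact X)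
    {Y : Finset V} (hY : ↑Y ⊆ X) : finsetMagnitude t Y ≤ setMagnitude t X := by
  obtain ⟨f, hf, -⟩ := exists_schwartz_eq_one_on hX isOpen_univ (subset_univ X)
  refine le_csSup ⟨t ^ Module.finrank ℝ V * expEnergy f t, ?_⟩ ⟨Y, hY, rfl⟩
  rintro _ ⟨Z, hZ, rfl⟩
  exact finsetMagnitude_le_s4 ht fun x hx => hf x (hZ hx)

theorem integral_exp_neg_mul_norm_sub {t : ℝ} (ht : 0 < t) (a : V) :
    ∫ x : V, Real.exp (-(t * ‖a - x‖)) =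
      (∫ x : V, Real.exp (-‖x‖)) / t ^ Module.finrank ℝ V := by
  rw [integral_sub_left_eq_self (fun x : V => Real.exp (-(t * ‖x‖))) volume a]
  have h := Measure.integral_comp_smul volume (fun x : V => Real.exp (-‖x‖)) t
  simp only [norm_smul, Real.norm_eq_abs, abs_of_pos ht] at h
  rw [h, abs_of_pos (by positivity), smul_eq_mul, inv_mul_eq_div]

theorem integrable_exp_neg_mul_norm_sub {t : ℝ} (ht : 0 < t) (a : V) :
    Integrable (fun x : V => Real.exp (-(t * ‖a - x‖))) := by
  have h := (integrable_exp_neg_norm (V := V)).comp_smul ht.ne'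
  simp only [norm_smul, Real.norm_eq_abs, abs_of_pos ht] at h
  exact h.comp_sub_left a

theorem volume_div_mul_exp_le_setMagnitude {t δ : ℝ} (ht : 0 < t) (hδ : 0 < δ) {X : Set V}
    (hX : IsCompact X) :
    (volume X).toReal / (∫ x : V, Real.exp (-‖x‖)) * t ^ Module.finrank ℝ V *
      Real.exp (-(t * δ)) ≤ setMagnitude t X := by
  classical
  obtain ⟨Y, hYX, hcov⟩ := hX.elim_nhds_subcover (fun x => Metric.ball x δ)
    fun x _ => Metric.ball_mem_nhds x hδ
  obtain ⟨B, hBm, hBd, hBX, hBδ⟩ := exists_measurable_partition_of_cover hX.measurableSet hcov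
  refine le_trans ?_ (finsetMagnitude_le_setMagnitude ht hX hYX)
  set I := ∫ x : V, Real.exp (-‖x‖) with hI
  have hI0 : 0 < I := by
    rw [hI, integral_exp_neg_norm_eq]
    exact expNormFourier_pos _
  set d := Module.finrank ℝ V
  set m : ↥Y → ℝ := fun a => (volume (B a)).toReal
  have hfin : ∀ a, volume (B a) ≠ ⊤ := fun a =>
    measure_ne_top_of_subset (hBδ a) measure_ball_lt_top.ne
  have hsum : ∑ a, m a = (volume X).toReal := by
    rw [← hBX, measure_iUnion hBd hBm, tsum_fintype, ENNReal.toReal_sum fun a _ => hfin a]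
  have hrow : ∀ a : ↥Y, ∑ b : ↥Y, m b * Real.exp (-(t * ‖(a : V) - b‖)) ≤
      Real.exp (t * δ) * (I / t ^ d) := by
    intro a
    have hint := (integrable_exp_neg_mul_norm_sub ht (a : V)).const_mul (Real.exp (t * δ))
    calc ∑ b : ↥Y, m b * Real.exp (-(t * ‖(a : V) - b‖))
        ≤ ∑ b : ↥Y, ∫ x in B b, Real.exp (t * δ) * Real.exp (-(t * ‖(a : V) - x‖)) := by
          refine Finset.sum_le_sum fun b _ => ?_
          rw [show m b = volume.real (B b) from rfl, ← smul_eq_mul, ← setIntegral_const]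
          refine setIntegral_mono_on (integrableOn_const (hfin b)) hint.integrableOn (hBm b)
            fun x hx => ?_
          rw [← Real.exp_add]
          refine Real.exp_le_exp.2 ?_
          have h1 : dist x (b : V) < δ := hBδ b hx
          have h2 : ‖(a : V) - x‖ ≤ ‖(a : V) - b‖ + δ := by
            rw [← dist_eq_norm, ← dist_eq_norm]
            have := dist_triangle_right (a : V) x b
            linarith
          nlinarith
      _ = ∫ x in X, Real.exp (t * δ) * Real.exp (-(t * ‖(a : V) - x‖)) := by
          rw [← hBX, integral_iUnion_fintype hBm hBd fun _ => hint.integrableOn]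
      _ ≤ ∫ x, Real.exp (t * δ) * Real.exp (-(t * ‖(a : V) - x‖)) :=
          setIntegral_le_integral hint (Eventually.of_forall fun x => by positivity)
      _ = Real.exp (t * δ) * (I / t ^ d) := by
          rw [integral_const_mul, integral_exp_neg_mul_norm_sub ht]
  set c := Real.exp (t * δ) * (I / t ^ d) with hc
  have hc0 : 0 < c := by positivity
  refine le_trans ?_ (le_finsetMagnitude ht Y fun a => c⁻¹ * m a)
  have hquad : ∑ a, ∑ b, (c⁻¹ * m a) * (c⁻¹ * m b) * Real.exp (-(t * ‖(a : V) - b‖)) ≤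
      c⁻¹ * (volume X).toReal := by
    rw [← hsum, Finset.mul_sum]
    refine Finset.sum_le_sum fun a _ => ?_
    have hma : 0 ≤ m a := ENNReal.toReal_nonneg
    calc ∑ b, (c⁻¹ * m a) * (c⁻¹ * m b) * Real.exp (-(t * ‖(a : V) - b‖))
        = (c⁻¹ * m a) * c⁻¹ * ∑ b, m b * Real.exp (-(t * ‖(a : V) - b‖)) := by
          rw [Finset.mul_sum]
          refine Finset.sum_congr rfl fun b _ => ?_
          ring
      _ ≤ (c⁻¹ * m a) * c⁻¹ * c := by
          gcongr
          exact hrow a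
      _ = c⁻¹ * m a := by
          field_simp
  have hlin : ∑ a, c⁻¹ * m a = c⁻¹ * (volume X).toReal := by rw [← Finset.mul_sum, hsum]
  have hval : (volume X).toReal / I * t ^ d * Real.exp (-(t * δ)) = c⁻¹ * (volume X).toReal := by
    rw [hc, Real.exp_neg]
    field_simp
  rw [hlin, hval]
  linarith

theorem volume_div_mul_le_setMagnitude {t : ℝ} (ht : 0 < t) {X : Set V} (hX : IsCompact X) :
    (volume X).toReal / (∫ x : V, Real.exp (-‖x‖)) * t ^ Module.finrank ℝ V ≤
      setMagnitude t X := by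
  have h : Tendsto (fun δ : ℝ => (volume X).toReal / (∫ x : V, Real.exp (-‖x‖)) *
      t ^ Module.finrank ℝ V * Real.exp (-(t * δ))) (𝓝[>] 0)
      (𝓝 ((volume X).toReal / (∫ x : V, Real.exp (-‖x‖)) * t ^ Module.finrank ℝ V *
        Real.exp (-(t * 0)))) :=
    (Continuous.tendsto (by fun_prop) 0).mono_left nhdsWithin_le_nhds
  rw [mul_zero, neg_zero, Real.exp_zero, mul_one] at h
  refine le_of_tendsto h ?_
  filter_upwards [self_mem_nhdsWithin] with δ hδ
  exact volume_div_mul_exp_le_setMagnitude ht hδ hX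

theorem tendsto_setMagnitude_div_pow {X : Set V} (hX : IsCompact X) :
    Tendsto (fun t : ℝ => setMagnitude t X / t ^ Module.finrank ℝ V) atTop
      (𝓝 ((volume X).toReal / ∫ x : V, Real.exp (-‖x‖))) := by
  set I := ∫ x : V, Real.exp (-‖x‖) with hI
  have hI0 : 0 < I := by
    rw [hI, integral_exp_neg_norm_eq]
    exact expNormFourier_pos _
  rw [tendsto_order]
  refine ⟨fun a ha => ?_, fun b hb => ?_⟩
  · filter_upwards [eventually_gt_atTop (0 : ℝ)] with t ht
    refine ha.trans_le ?_
    rw [le_div_iff₀ (pow_pos ht _)]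
    exact volume_div_mul_le_setMagnitude ht hX
  · have hlt : volume X < ENNReal.ofReal (b * I) := by
      rw [ENNReal.lt_ofReal_iff_toReal_lt hX.measure_lt_top.ne]
      exact (div_lt_iff₀ hI0).1 hb
    obtain ⟨U, hXU, hU, hUb⟩ := X.exists_isOpen_lt_of_lt _ hlt
    obtain ⟨f, hf1, hfle, hf0⟩ := exists_schwartz_eq_one_on hX hU hXU
    have hUfin : volume U ≠ ⊤ := (hUb.trans ENNReal.ofReal_lt_top).ne
    have hf2 : ∫ x, ‖f x‖ ^ 2 ≤ (volume U).toReal := by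
      rw [← measureReal_def, ← integral_indicator_one hU.measurableSet]
      refine integral_mono_of_nonneg (Eventually.of_forall fun x => by positivity)
        ((integrable_indicator_iff hU.measurableSet).2 (integrableOn_const hUfin))
        (Eventually.of_forall fun x => ?_)
      by_cases hx : x ∈ U
      · simpa [hx] using hfle x
      · simp [hx, hf0 x hx]
    have hlim : (∫ x, ‖f x‖ ^ 2) / I < b := by
      rw [div_lt_iff₀ hI0]
      exact hf2.trans_lt ((ENNReal.lt_ofReal_iff_toReal_lt hUfin).1 hUb)
    filter_upwards [eventually_gt_atTop (0 : ℝ), (tendsto_expEnergy f).eventually_lt_const hlim]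
      with t ht hE
    refine lt_of_le_of_lt ?_ hE
    rw [div_le_iff₀' (pow_pos ht _)]
    exact setMagnitude_le ht hf1

end ExpKernel

end MagnitudeAsymptotics

/-- For X ⊆ ℝⁿ nonempty and compact,
Mag(tX)/tⁿ → Vol(X)/(n!·Vol(Bₙ)) as t → ∞, where Bₙ is the unit ball in ℝⁿ. -/
theorem magnitude_volume_limit {n : ℕ} (X : Set (EuclideanSpace ℝ (Fin n)))
    (hne : X.Nonempty) (hcpt : IsCompact X) :
    Filter.Tendsto (fun t : ℝ => setMagnitude t X / t ^ n) Filter.atTop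
      (nhds ((MeasureTheory.volume X).toReal /
        ((n.factorial : ℝ) *
          (MeasureTheory.volume (Metric.ball (0 : EuclideanSpace ℝ (Fin n)) 1)).toReal))) := by
  have h := tendsto_setMagnitude_div_pow hcpt
  rwa [integral_exp_neg_norm_eq_factorial_mul, finrank_euclideanSpace_fin] at h
end

section
/- Let X be a finite metric space with n points that is scattered, i.e. e^{−ε} < 1/(n−1) where ε is the smallest distance between distinct points of X. Then the similarity matrix ζ_X is invertible and its inverse is given by the convergent series ζ_X⁻¹ = Σ_{k=0}^{∞} (−1)^k (ζ_X − I)^k, where I is the n × n identity matrix. -/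
open Matrix

section

attribute [local instance] Matrix.linftyOpNormedRing Matrix.linftyOpNormedSpace

/-- A real matrix each of whose rows has absolute sum less than one generates a geometric
(Neumann) series. -/
theorem Matrix.summable_pow_and_mul_tsum_pow_of_rowSum_lt_one {n : Type*} [Fintype n]
    [DecidableEq n] (A : Matrix n n ℝ) (hA : ∀ i, ∑ j, |A i j| < 1) :
    Summable (fun k : ℕ => A ^ k) ∧ (1 - A) * ∑' k : ℕ, A ^ k = 1 := by
  have hnorm : ‖A‖ < 1 := by
    rw [← coe_nnnorm, ← NNReal.coe_one, NNReal.coe_lt_coe, Matrix.linfty_opNNNorm_def,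
      Finset.sup_lt_iff (by simp)]
    intro i _
    rw [← NNReal.coe_lt_coe]
    simpa using hA i
  have : CompleteSpace (Matrix n n ℝ) := FiniteDimensional.complete ℝ _
  exact ⟨summable_geometric_of_norm_lt_one hnorm, mul_neg_geom_series A hnorm⟩

end

/-- The off-diagonal row sums of the similarity matrix of a scattered space are less than one. -/
theorem sum_abs_similarity_sub_one_lt_one {X : Type*} [Fintype X] [DecidableEq X] [MetricSpace X]
    (ε : ℝ) (hε : IsLeast { d : ℝ | ∃ a b : X, a ≠ b ∧ d = dist a b } ε)
    (hscat : Real.exp (-ε) < 1 / ((Fintype.card X : ℝ) - 1)) (i : X) :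
    ∑ j, |((Matrix.of fun a b : X => Real.exp (-dist a b)) - 1) i j| < 1 := by
  obtain ⟨a, b, hab, -⟩ := hε.1
  have hcard : (1 : ℝ) < Fintype.card X := by
    exact_mod_cast Fintype.one_lt_card_iff.mpr ⟨a, b, hab⟩
  have hentry : ∀ j ∈ Finset.univ.erase i,
      |((Matrix.of fun a b : X => Real.exp (-dist a b)) - 1) i j| ≤ Real.exp (-ε) := by
    intro j hj
    have hij : i ≠ j := (Finset.ne_of_mem_erase hj).symm
    have hle : ε ≤ dist i j := hε.2 ⟨i, j, hij, rfl⟩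
    simpa [Matrix.one_apply_ne hij] using hle
  rw [← Finset.add_sum_erase _ _ (Finset.mem_univ i)]
  calc _ ≤ 0 + ((Finset.univ.erase i).card : ℝ) * Real.exp (-ε) := by
        refine add_le_add (by simp) ?_
        simpa using Finset.sum_le_card_nsmul _ _ _ hentry
    _ = Real.exp (-ε) * ((Fintype.card X : ℝ) - 1) := by
        rw [Finset.card_erase_of_mem (Finset.mem_univ i), Finset.card_univ,
          Nat.cast_sub (by exact_mod_cast hcard.le)]
        push_cast
        ring
    _ < 1 := (lt_div_iff₀ (by linarith)).mp hscat

/-- Let X be a finite metric space with n points that is scattered, i.e.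
e^{−ε} < 1/(n−1) where ε is the smallest distance between distinct points of X. Then
ζ_X is invertible and ζ_X⁻¹ = Σ_{k=0}^{∞} (−1)^k (ζ_X − I)^k, the series converging. -/
theorem scattered_inverse_series {X : Type*} [Fintype X] [DecidableEq X] [MetricSpace X]
    (ε : ℝ) (hε : IsLeast { d : ℝ | ∃ a b : X, a ≠ b ∧ d = dist a b } ε)
    (hscat : Real.exp (-ε) < 1 / ((Fintype.card X : ℝ) - 1)) :
    IsUnit (Matrix.of fun a b : X => Real.exp (-dist a b)).det ∧
    Summable (fun k : ℕ =>
      ((-1 : ℝ) ^ k • ((Matrix.of fun a b : X => Real.exp (-dist a b)) - 1) ^ k)) ∧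
    (Matrix.of fun a b : X => Real.exp (-dist a b))⁻¹ =
      ∑' k : ℕ, (-1 : ℝ) ^ k • ((Matrix.of fun a b : X => Real.exp (-dist a b)) - 1) ^ k := by
  set Z : Matrix X X ℝ := Matrix.of fun a b : X => Real.exp (-dist a b) with hZ
  have hpow : (fun k : ℕ => (-1 : ℝ) ^ k • (Z - 1) ^ k) = fun k => (1 - Z) ^ k := by
    funext k
    rw [← smul_pow, neg_one_smul, neg_sub]
  obtain ⟨hsum, hmul⟩ := Matrix.summable_pow_and_mul_tsum_pow_of_rowSum_lt_one (1 - Z) fun i => by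
    simpa only [← neg_sub Z 1, Matrix.neg_apply, abs_neg] using
      sum_abs_similarity_sub_one_lt_one ε hε hscat i
  rw [sub_sub_cancel] at hmul
  rw [hpow]
  exact ⟨Matrix.isUnit_det_of_right_inverse hmul, hsum, Matrix.inv_eq_right_inv hmul⟩
end

section
/- Let X be a finite metric space with n points that is scattered, i.e. e^{−ε} < 1/(n−1) where ε is the smallest distance between distinct points of X. Then every entry of the inverse similarity matrix satisfies |ζ_X⁻¹(a,b)| ≤ 1/(1 − (n−1)·e^{−ε}) for all a, b ∈ X. -/
open Matrix

/-- If a square matrix of size `n` has unit diagonal and its off-diagonal entries are bounded by `q`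
in absolute value, where `(n - 1) q < 1`, then the entries of its inverse are bounded by
`1 / (1 - (n - 1) q)`. -/
theorem abs_inv_apply_le_of_abs_offDiag_le {ι : Type*} [Fintype ι] [DecidableEq ι]
    {A : Matrix ι ι ℝ} {q : ℝ} (hdiag : ∀ i, A i i = 1) (hoff : ∀ i j, i ≠ j → |A i j| ≤ q)
    (hq : ((Fintype.card ι : ℝ) - 1) * q < 1) (a b : ι) :
    |A⁻¹ a b| ≤ 1 / (1 - ((Fintype.card ι : ℝ) - 1) * q) := by
  have card_erase (i : ι) : ((Finset.univ.erase i).card : ℝ) = (Fintype.card ι : ℝ) - 1 := by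
    rw [Finset.cast_card_erase_of_mem (Finset.mem_univ i), Finset.card_univ]
  have hdet : A.det ≠ 0 := by
    refine det_ne_zero_of_sum_row_lt_diag fun i => ?_
    calc ∑ j ∈ Finset.univ.erase i, ‖A i j‖ ≤ ∑ _j ∈ Finset.univ.erase i, q :=
          Finset.sum_le_sum fun j hj => hoff i j (Finset.ne_of_mem_erase hj).symm
      _ < ‖A i i‖ := by
          rw [Finset.sum_const, nsmul_eq_mul, card_erase, hdiag, norm_one]
          exact hq
  have hmul : A * A⁻¹ = 1 := mul_nonsing_inv A hdet.isUnit
  obtain ⟨m, -, hm⟩ := Finset.exists_max_image Finset.univ (fun i => |A⁻¹ i b|)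
    ⟨a, Finset.mem_univ a⟩
  have hrow : A⁻¹ m b = (1 : Matrix ι ι ℝ) m b - ∑ j ∈ Finset.univ.erase m, A m j * A⁻¹ j b := by
    rw [← hmul, mul_apply, ← Finset.add_sum_erase _ _ (Finset.mem_univ m), hdiag]
    ring
  have hone : |(1 : Matrix ι ι ℝ) m b| ≤ 1 := by
    rw [one_apply]
    split_ifs <;> simp
  have hsum : |∑ j ∈ Finset.univ.erase m, A m j * A⁻¹ j b| ≤
      ((Fintype.card ι : ℝ) - 1) * (q * |A⁻¹ m b|) := by
    calc |∑ j ∈ Finset.univ.erase m, A m j * A⁻¹ j b|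
        ≤ ∑ j ∈ Finset.univ.erase m, |A m j * A⁻¹ j b| := Finset.abs_sum_le_sum_abs _ _
      _ ≤ ∑ _j ∈ Finset.univ.erase m, q * |A⁻¹ m b| := by
          refine Finset.sum_le_sum fun j hj => ?_
          have hmj := hoff m j (Finset.ne_of_mem_erase hj).symm
          rw [abs_mul]
          exact mul_le_mul hmj (hm j (Finset.mem_univ j)) (abs_nonneg _)
            ((abs_nonneg _).trans hmj)
      _ = ((Fintype.card ι : ℝ) - 1) * (q * |A⁻¹ m b|) := by
          rw [Finset.sum_const, nsmul_eq_mul, card_erase]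
  have hmax : |A⁻¹ m b| ≤ 1 + ((Fintype.card ι : ℝ) - 1) * (q * |A⁻¹ m b|) := by
    calc |A⁻¹ m b| ≤ |(1 : Matrix ι ι ℝ) m b| + |∑ j ∈ Finset.univ.erase m, A m j * A⁻¹ j b| := by
          conv_lhs => rw [hrow]
          exact abs_sub _ _
      _ ≤ _ := add_le_add hone hsum
  refine (hm a (Finset.mem_univ a)).trans ?_
  rw [le_div_iff₀ (sub_pos.mpr hq)]
  linarith

/-- Let X be a finite metric space with n points that is scattered, i.e.
e^{−ε} < 1/(n−1) where ε is the smallest distance between distinct points of X. Then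
|ζ_X⁻¹(a,b)| ≤ 1/(1 − (n−1)·e^{−ε}) for all a, b ∈ X. -/
theorem scattered_inverse_entry_bound {X : Type*} [Fintype X] [DecidableEq X] [MetricSpace X]
    (ε : ℝ) (hε : IsLeast { d : ℝ | ∃ a b : X, a ≠ b ∧ d = dist a b } ε)
    (hscat : Real.exp (-ε) < 1 / ((Fintype.card X : ℝ) - 1))
    (a b : X) :
    |(Matrix.of fun c d : X => Real.exp (-dist c d))⁻¹ a b| ≤
      1 / (1 - ((Fintype.card X : ℝ) - 1) * Real.exp (-ε)) := by
  obtain ⟨⟨x, y, hxy, -⟩, hmin⟩ := hε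
  have hcard : (1 : ℝ) < Fintype.card X := by
    exact_mod_cast Fintype.one_lt_card_iff.mpr ⟨x, y, hxy⟩
  refine abs_inv_apply_le_of_abs_offDiag_le (fun i => by simp) (fun i j hij => ?_) ?_ a b
  · rw [of_apply, abs_of_pos (Real.exp_pos _), Real.exp_le_exp, neg_le_neg_iff]
    exact hmin ⟨i, j, hij, rfl⟩
  · rw [mul_comm]
    exact (lt_div_iff₀ (sub_pos.mpr hcard)).mp hscat
end

section
/- Let X be a finite metric space with n points that is scattered, i.e. e^{−ε} < 1/(n−1) where ε is the smallest distance between distinct points of X. Then for every x ∈ X, |w_X(x) − 1/(n·f(x))| ≤ (n(n−1)²e^{−2ε} + n(n−1)e^{−ε}) / (1 − (n−1)e^{−ε}), where f(x) = (1/n)·Σ_{b∈X} exp(−d(x,b)) is the kernel density estimator associated with the Laplacian kernel and w_X = ζ_X⁻¹𝟙 is the weighting vector. -/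
open Matrix

/-- If `A` has unit diagonal and off-diagonal absolute row sums at most `t < 1`, then every entry of a
solution of `A w = 1` is at most `1 / (1 - t)` in absolute value. -/
theorem abs_le_of_mulVec_eq_one {ι : Type*} [Fintype ι] [DecidableEq ι] {A : Matrix ι ι ℝ}
    {w : ι → ℝ} {t : ℝ} (ht : t < 1) (hdiag : ∀ i, A i i = 1)
    (hrow : ∀ i, ∑ j ∈ Finset.univ.erase i, |A i j| ≤ t) (hw : A *ᵥ w = fun _ => 1) (i : ι) :
    |w i| ≤ 1 / (1 - t) := by
  obtain ⟨k, -, hk⟩ := Finset.exists_max_image Finset.univ (fun j => |w j|) ⟨i, Finset.mem_univ i⟩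
  have hwk : w k + ∑ j ∈ Finset.univ.erase k, A k j * w j = 1 := by
    have := congrFun hw k
    rwa [mulVec, dotProduct, ← Finset.add_sum_erase _ _ (Finset.mem_univ k), hdiag, one_mul] at this
  have hsum : |∑ j ∈ Finset.univ.erase k, A k j * w j| ≤ t * |w k| := calc
    _ ≤ ∑ j ∈ Finset.univ.erase k, |A k j * w j| := Finset.abs_sum_le_sum_abs _ _
    _ ≤ ∑ j ∈ Finset.univ.erase k, |A k j| * |w k| := Finset.sum_le_sum fun j _ => by
      rw [abs_mul]
      exact mul_le_mul_of_nonneg_left (hk j (Finset.mem_univ j)) (abs_nonneg _)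
    _ ≤ t * |w k| := by
      rw [← Finset.sum_mul]
      exact mul_le_mul_of_nonneg_right (hrow k) (abs_nonneg _)
  have hbound : |w k| ≤ 1 + t * |w k| := by
    have hwk' : w k = 1 - ∑ j ∈ Finset.univ.erase k, A k j * w j := by linarith
    calc |w k| = |1 - ∑ j ∈ Finset.univ.erase k, A k j * w j| := congrArg _ hwk'
      _ ≤ |1| + |∑ j ∈ Finset.univ.erase k, A k j * w j| := abs_sub _ _
      _ ≤ 1 + t * |w k| := by rw [abs_one]; linarith
  refine (hk i (Finset.mem_univ i)).trans ?_
  rw [le_div_iff₀ (by linarith)]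
  linarith

/-- For a matrix with nonnegative entries, unit diagonal and off-diagonal row sums at most `t < 1`,
the solution of `A w = 1` is close to the inverse row sums. -/
theorem abs_sub_inv_rowSum_le {ι : Type*} [Fintype ι] [DecidableEq ι] {A : Matrix ι ι ℝ}
    {w : ι → ℝ} {t : ℝ} (ht : t < 1) (hdiag : ∀ i, A i i = 1) (hA : ∀ i j, 0 ≤ A i j)
    (hrow : ∀ i, ∑ j ∈ Finset.univ.erase i, A i j ≤ t) (hw : A *ᵥ w = fun _ => 1) (i : ι) :
    |w i - 1 / ∑ j, A i j| ≤ 2 * t / (1 - t) := by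
  have hwb := abs_le_of_mulVec_eq_one ht hdiag (by simpa only [abs_of_nonneg (hA _ _)] using hrow) hw
  have hone : 1 ≤ ∑ j, A i j :=
    (hdiag i).symm.le.trans (Finset.single_le_sum (fun j _ => hA i j) (Finset.mem_univ i))
  have hnum : (∑ j, A i j) * w i - 1 = ∑ j ∈ Finset.univ.erase i, A i j * (w i - w j) := by
    have hwi : ∑ j, A i j * w j = 1 := congrFun hw i
    rw [Finset.sum_erase _ (by simp), ← hwi, Finset.sum_mul, ← Finset.sum_sub_distrib]
    exact Finset.sum_congr rfl fun j _ => by ring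
  have hdiff : w i - 1 / ∑ j, A i j = ((∑ j, A i j) * w i - 1) / ∑ j, A i j := by
    have : ∑ j, A i j ≠ 0 := by linarith
    field_simp
  rw [hdiff, abs_div, abs_of_pos (zero_lt_one.trans_le hone)]
  refine (div_le_self (abs_nonneg _) hone).trans ?_
  rw [hnum]
  calc _ ≤ ∑ j ∈ Finset.univ.erase i, |A i j * (w i - w j)| := Finset.abs_sum_le_sum_abs _ _
    _ ≤ ∑ j ∈ Finset.univ.erase i, A i j * (2 * (1 / (1 - t))) := Finset.sum_le_sum fun j _ => by
      rw [abs_mul, abs_of_nonneg (hA i j)]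
      refine mul_le_mul_of_nonneg_left ?_ (hA i j)
      linarith [abs_sub (w i) (w j), hwb i, hwb j]
    _ ≤ t * (2 * (1 / (1 - t))) := by
      rw [← Finset.sum_mul]
      have : 0 < 1 - t := by linarith
      exact mul_le_mul_of_nonneg_right (hrow i) (by positivity)
    _ = 2 * t / (1 - t) := by ring

/-- Let X be a finite metric space with n points that is scattered, i.e.
e^{−ε} < 1/(n−1) where ε is the smallest distance between distinct points of X. Then
for every x ∈ X, |w_X(x) − 1/(n·f(x))| ≤ (n(n−1)²e^{−2ε} + n(n−1)e^{−ε})/(1 − (n−1)e^{−ε}),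
where f(x) = (1/n)·Σ_{b∈X} exp(−d(x,b)) and w_X = ζ_X⁻¹𝟙. -/
theorem weight_kernel_density_bound {X : Type*} [Fintype X] [DecidableEq X] [MetricSpace X]
    (ε : ℝ) (hε : IsLeast { d : ℝ | ∃ a b : X, a ≠ b ∧ d = dist a b } ε)
    (hscat : Real.exp (-ε) < 1 / ((Fintype.card X : ℝ) - 1))
    (x : X) :
    |((Matrix.of fun c d : X => Real.exp (-dist c d))⁻¹ *ᵥ fun _ : X => (1 : ℝ)) x -
        1 / ((Fintype.card X : ℝ) *
          ((1 / (Fintype.card X : ℝ)) * ∑ b : X, Real.exp (-dist x b)))| ≤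
      ((Fintype.card X : ℝ) * ((Fintype.card X : ℝ) - 1) ^ 2 * Real.exp (-(2 * ε)) +
        (Fintype.card X : ℝ) * ((Fintype.card X : ℝ) - 1) * Real.exp (-ε)) /
      (1 - ((Fintype.card X : ℝ) - 1) * Real.exp (-ε)) := by
  obtain ⟨⟨a, b, hab, -⟩, hmin⟩ := hε
  have hn : (2 : ℝ) ≤ Fintype.card X := by
    exact_mod_cast Nat.succ_le_of_lt (Fintype.one_lt_card_iff.2 ⟨a, b, hab⟩)
  set n : ℝ := (Fintype.card X : ℝ)
  set A : Matrix X X ℝ := Matrix.of fun c d : X => Real.exp (-dist c d)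
  have ht : (n - 1) * Real.exp (-ε) < 1 := by
    rw [lt_div_iff₀ (by linarith)] at hscat
    linarith
  have hdiag : ∀ c, A c c = 1 := fun c => by simp [A]
  have hnonneg : ∀ c d, 0 ≤ A c d := fun c d => (Real.exp_pos _).le
  have hrow : ∀ c, ∑ d ∈ Finset.univ.erase c, A c d ≤ (n - 1) * Real.exp (-ε) := fun c => by
    have hle := Finset.sum_le_card_nsmul (Finset.univ.erase c) (A c) (Real.exp (-ε)) fun d hd =>
      Real.exp_le_exp.2 (neg_le_neg (hmin ⟨c, d, (Finset.ne_of_mem_erase hd).symm, rfl⟩))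
    rwa [nsmul_eq_mul, Finset.cast_card_erase_of_mem (Finset.mem_univ c), Finset.card_univ] at hle
  have hdet : A.det ≠ 0 := det_ne_zero_of_sum_row_lt_diag fun c => by
    simp only [Real.norm_of_nonneg (hnonneg _ _), hdiag, norm_one]
    exact (hrow c).trans_lt ht
  have hw : A *ᵥ (A⁻¹ *ᵥ fun _ => 1) = fun _ => 1 := by
    rw [mulVec_mulVec, mul_nonsing_inv _ hdet.isUnit, one_mulVec]
  have hmean : n * (1 / n * ∑ b : X, Real.exp (-dist x b)) = ∑ b, A x b := by
    rw [← mul_assoc, mul_one_div_cancel (by linarith), one_mul]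
    rfl
  rw [hmean]
  refine (abs_sub_inv_rowSum_le ht hdiag hnonneg hrow hw x).trans ?_
  refine div_le_div_of_nonneg_right ?_ (by linarith)
  have hq : 0 ≤ (n - 1) * Real.exp (-ε) := mul_nonneg (by linarith) (Real.exp_pos _).le
  have hsq : 0 ≤ n * (n - 1) ^ 2 * Real.exp (-(2 * ε)) := by positivity
  nlinarith [mul_le_mul_of_nonneg_right hn hq]
end

section
/- Let K be an n × n symmetric positive definite real matrix indexed by a finite set X with n points, with K(x,x) = 1 for all x ∈ X and K(a,b) ≥ 0 for all a, b, and let K_max denote the largest value of K(a,b) over distinct a ≠ b. If X is K-scattered, i.e. K_max < 1/(n−1), then for every x ∈ X, |w(x) − 1/(n·f_K(x))| ≤ (n(n−1)²K_max² + n(n−1)K_max) / (1 − (n−1)K_max), where w = K⁻¹𝟙 and f_K(x) = (1/n)·Σ_{b∈X} K(x,b). -/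
open Matrix

/-- If the off-diagonal entries of a matrix with unit diagonal lie in `[0, k]`, then a row applied
to a vector bounded by `M` deviates from the diagonal term by at most `(n - 1) * k * M`. -/
theorem abs_mulVec_sub_apply_le {X : Type*} [Fintype X] [DecidableEq X] (K : Matrix X X ℝ)
    (hdiag : ∀ x : X, K x x = 1) (hnonneg : ∀ a b : X, 0 ≤ K a b) {k : ℝ}
    (hk : ∀ a b : X, a ≠ b → K a b ≤ k) {v : X → ℝ} {M : ℝ} (hM : ∀ b, |v b| ≤ M) (a : X) :
    |(K *ᵥ v) a - v a| ≤ ((Fintype.card X : ℝ) - 1) * k * M := by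
  have hsplit : (K *ᵥ v) a - v a = ∑ b ∈ Finset.univ.erase a, K a b * v b := by
    have h := Finset.add_sum_erase Finset.univ (fun b => K a b * v b) (Finset.mem_univ a)
    simp only [hdiag, one_mul] at h
    simp only [mulVec, dotProduct]
    linarith
  have hM0 : 0 ≤ M := (abs_nonneg _).trans (hM a)
  have hcard : ((Finset.univ.erase a).card : ℝ) = (Fintype.card X : ℝ) - 1 := by
    rw [Finset.card_erase_of_mem (Finset.mem_univ a), Finset.card_univ,
      Nat.cast_pred (Fintype.card_pos_iff.mpr ⟨a⟩)]
  calc |(K *ᵥ v) a - v a| ≤ ∑ b ∈ Finset.univ.erase a, |K a b * v b| := by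
        rw [hsplit]
        exact Finset.abs_sum_le_sum_abs _ _
    _ ≤ ∑ _b ∈ Finset.univ.erase a, k * M := by
        refine Finset.sum_le_sum fun b hb => ?_
        have hab := hk a b (Finset.ne_of_mem_erase hb).symm
        rw [abs_mul, abs_of_nonneg (hnonneg a b)]
        exact mul_le_mul hab (hM b) (abs_nonneg _) ((hnonneg a b).trans hab)
    _ = ((Fintype.card X : ℝ) - 1) * k * M := by
        rw [Finset.sum_const, nsmul_eq_mul, hcard, mul_assoc]

/-- Let K be an n × n symmetric positive definite real matrix indexed by a
finite set X with n points, with unit diagonal and nonnegative entries, and let K_max be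
the largest value of K on distinct indices. If X is K-scattered, i.e. K_max < 1/(n−1),
then for every x ∈ X, |w(x) − 1/(n·f_K(x))| ≤ (n(n−1)²K_max² + n(n−1)K_max)/(1 − (n−1)K_max),
where w = K⁻¹𝟙 and f_K(x) = (1/n)·Σ_{b∈X} K(x,b). -/
theorem kernel_scattered_weight_bound {X : Type*} [Fintype X] [DecidableEq X]
    (K : Matrix X X ℝ) (hK : K.PosDef)
    (hdiag : ∀ x : X, K x x = 1)
    (hnonneg : ∀ a b : X, 0 ≤ K a b)
    (Kmax : ℝ) (hKmax : IsGreatest { v : ℝ | ∃ a b : X, a ≠ b ∧ v = K a b } Kmax)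
    (hscat : Kmax < 1 / ((Fintype.card X : ℝ) - 1))
    (x : X) :
    |(K⁻¹ *ᵥ fun _ : X => (1 : ℝ)) x -
        1 / ((Fintype.card X : ℝ) * ((1 / (Fintype.card X : ℝ)) * ∑ b : X, K x b))| ≤
      ((Fintype.card X : ℝ) * ((Fintype.card X : ℝ) - 1) ^ 2 * Kmax ^ 2 +
        (Fintype.card X : ℝ) * ((Fintype.card X : ℝ) - 1) * Kmax) /
      (1 - ((Fintype.card X : ℝ) - 1) * Kmax) := by
  obtain ⟨⟨p, q, hpq, hKpq⟩, hub⟩ := hKmax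
  have hk : ∀ a b : X, a ≠ b → K a b ≤ Kmax := fun a b hab => hub ⟨a, b, hab, rfl⟩
  have hk0 : 0 ≤ Kmax := hKpq ▸ hnonneg p q
  have hn : (2 : ℝ) ≤ Fintype.card X := by
    exact_mod_cast Fintype.one_lt_card_iff.mpr ⟨p, q, hpq⟩
  set n : ℝ := (Fintype.card X : ℝ)
  set w := K⁻¹ *ᵥ fun _ : X => (1 : ℝ) with hw
  have hKw : K *ᵥ w = fun _ => 1 := by
    rw [hw, mulVec_mulVec, mul_nonsing_inv K (isUnit_iff_isUnit_det K |>.mp hK.isUnit),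
      one_mulVec]
  have ht1 : (n - 1) * Kmax < 1 := by
    rw [lt_div_iff₀ (by linarith)] at hscat
    linarith
  have ht0 : 0 ≤ (n - 1) * Kmax := mul_nonneg (by linarith) hk0
  have : Nonempty X := ⟨x⟩
  obtain ⟨a, ha⟩ := Finite.exists_max fun b => |w b|
  have hwdev : ∀ b, |1 - w b| ≤ (n - 1) * Kmax * |w a| := fun b => by
    simpa [hKw] using abs_mulVec_sub_apply_le K hdiag hnonneg hk ha b
  have hM : |w a| * (1 - (n - 1) * Kmax) ≤ 1 := by
    have h1 := abs_sub_abs_le_abs_sub (w a) 1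
    rw [abs_sub_comm, abs_one] at h1
    linarith [hwdev a]
  have hrow : |∑ b, K x b - 1| ≤ (n - 1) * Kmax := by
    simpa [mulVec, dotProduct] using abs_mulVec_sub_apply_le K hdiag hnonneg hk
      (v := fun _ => 1) (M := 1) (by simp) x
  have hS : 1 ≤ ∑ b, K x b := by
    rw [← hdiag x]
    exact Finset.single_le_sum (fun b _ => hnonneg x b) (Finset.mem_univ x)
  rw [← mul_assoc, mul_one_div_cancel (by linarith), one_mul]
  generalize ∑ b, K x b = S at hrow hS
  have hinv : |1 - 1 / S| ≤ (n - 1) * Kmax := by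
    have hS0 : 0 < S := by linarith
    have h1 : 1 - 1 / S = (S - 1) / S := by field_simp
    rw [h1, abs_div, abs_of_pos hS0]
    exact (div_le_self (abs_nonneg _) hS).trans hrow
  have htri : |w x - 1 / S| ≤ (n - 1) * Kmax * |w a| + (n - 1) * Kmax := by
    have h1 := abs_sub_le (w x) 1 (1 / S)
    rw [abs_sub_comm (w x) 1] at h1
    linarith [hwdev x]
  rw [le_div_iff₀ (by linarith)]
  generalize ht : (n - 1) * Kmax = t at *
  have hrhs : n * (n - 1) ^ 2 * Kmax ^ 2 + n * (n - 1) * Kmax = n * (t * (t + 1)) := by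
    rw [← ht]
    ring
  rw [hrhs]
  calc |w x - 1 / S| * (1 - t) ≤ (t * |w a| + t) * (1 - t) :=
        mul_le_mul_of_nonneg_right htri (by linarith)
    _ ≤ 2 * (t * (t + 1)) := by nlinarith [mul_le_mul_of_nonneg_left hM ht0]
    _ ≤ n * (t * (t + 1)) := by gcongr
end
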